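/- arXiv:1407.0570 — 3 statements merged into one kernel-verified Lean document; each statement's English description precedes it below -/
import Mathlib

section
/- The number of permutations of length n (for n = 1,...,12) avoiding both patterns 1234 and 2341 is respectively 1, 2, 6, 22, 89, 376, 1611, 6901, 29375, 123996, 518971, 2155145. -/
/-- A pattern `π` (of length `k`) is contained in `σ` (of length `n`) if there is a
strictly increasing choice of positions whose values are ordered like `π`. -/
def PattContains {n k : ℕ} (σ : Fin n → Fin n) (π : Fin k → Fin k) : Prop :=
  ∃ f : Fin k → Fin n, StrictMono f ∧ ∀ i j : Fin k, π i < π j ↔ σ (f i) < σ (f j)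

/-- `σ` avoids the pattern `π`. -/
def PattAvoids {n k : ℕ} (σ : Fin n → Fin n) (π : Fin k → Fin k) : Prop :=
  ¬ PattContains σ π

/-- The number of permutations of length n avoiding both 1234 and 2341. -/
noncomputable def avF (n : ℕ) : ℕ :=
  Nat.card {σ : Equiv.Perm (Fin n) //
    PattAvoids (σ : Fin n → Fin n) (![0, 1, 2, 3] : Fin 4 → Fin 4) ∧
    PattAvoids (σ : Fin n → Fin n) (![1, 2, 3, 0] : Fin 4 → Fin 4)}

open Finset

namespace AvProof

/-- Append a last entry of value `p`, relabelling the others. -/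
def ext {n : ℕ} (p : Fin (n + 1)) (σ : Equiv.Perm (Fin n)) : Equiv.Perm (Fin (n + 1)) :=
  (finSuccEquivLast.trans σ.optionCongr).trans (finSuccEquiv' p).symm

lemma ext_last {n : ℕ} (p : Fin (n + 1)) (σ : Equiv.Perm (Fin n)) :
    ext p σ (Fin.last n) = p := by
  simp [ext]

lemma ext_castSucc {n : ℕ} (p : Fin (n + 1)) (σ : Equiv.Perm (Fin n)) (i : Fin n) :
    ext p σ i.castSucc = p.succAbove (σ i) := by
  simp [ext]

lemma ext_castSucc_val {n : ℕ} (p : Fin (n + 1)) (σ : Equiv.Perm (Fin n)) (i : Fin n) :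
    (ext p σ i.castSucc).val = if (σ i).val < p.val then (σ i).val else (σ i).val + 1 := by
  rw [ext_castSucc, Fin.succAbove]
  simp only [Fin.lt_def, Fin.val_castSucc]
  split_ifs <;> simp

lemma ext_bij (n : ℕ) : Function.Bijective
    (fun x : Fin (n + 1) × Equiv.Perm (Fin n) => ext x.1 x.2) := by
  rw [Fintype.bijective_iff_injective_and_card]
  constructor
  · rintro ⟨p, σ⟩ ⟨q, τ⟩ h
    simp only at h
    have hp : p = q := by
      have := congrArg (fun e => e (Fin.last n)) h
      simpa [ext_last] using this
    subst hp
    congr 1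
    ext1 i
    have := congrArg (fun e => e i.castSucc) h
    simpa [ext_castSucc] using this
  · simp [Fintype.card_perm, Nat.factorial_succ]

/-- There is a 12 with values in `[u, v)`. -/
def Q {n : ℕ} (σ : Equiv.Perm (Fin n)) (u v : ℕ) : Prop :=
  ∃ i j : Fin n, i.val < j.val ∧ (σ i).val < (σ j).val ∧ u ≤ (σ i).val ∧ (σ j).val < v

/-- There is a 123 with values in `[u, v)`. -/
def R {n : ℕ} (σ : Equiv.Perm (Fin n)) (u v : ℕ) : Prop :=
  ∃ i j k : Fin n, i.val < j.val ∧ j.val < k.val ∧ (σ i).val < (σ j).val ∧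
    (σ j).val < (σ k).val ∧ u ≤ (σ i).val ∧ (σ k).val < v

/-- There is a 1234. -/
def W1 {n : ℕ} (σ : Equiv.Perm (Fin n)) : Prop :=
  ∃ i j k l : Fin n, i.val < j.val ∧ j.val < k.val ∧ k.val < l.val ∧ (σ i).val < (σ j).val ∧
    (σ j).val < (σ k).val ∧ (σ k).val < (σ l).val

/-- There is a 2341. -/
def W2 {n : ℕ} (σ : Equiv.Perm (Fin n)) : Prop :=
  ∃ i j k l : Fin n, i.val < j.val ∧ j.val < k.val ∧ k.val < l.val ∧ (σ i).val < (σ j).val ∧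
    (σ j).val < (σ k).val ∧ (σ l).val < (σ i).val

lemma exists_last {n : ℕ} (P : Fin (n + 1) → Prop) :
    (∃ i, P i) ↔ (∃ i : Fin n, P i.castSucc) ∨ P (Fin.last n) := by
  constructor
  · rintro ⟨i, hi⟩
    induction i using Fin.lastCases with
    | last => exact Or.inr hi
    | cast i => exact Or.inl ⟨i, hi⟩
  · rintro (⟨i, hi⟩ | h)
    · exact ⟨_, hi⟩
    · exact ⟨_, h⟩

lemma patt1 {n : ℕ} (σ : Equiv.Perm (Fin n)) :
    PattContains (σ : Fin n → Fin n) (![0, 1, 2, 3] : Fin 4 → Fin 4) ↔ W1 σ := by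
  constructor
  · rintro ⟨f, hf, h⟩
    refine ⟨f 0, f 1, f 2, f 3, hf (by decide), hf (by decide), hf (by decide), ?_, ?_, ?_⟩
    · exact (h 0 1).1 (by decide)
    · exact (h 1 2).1 (by decide)
    · exact (h 2 3).1 (by decide)
  · rintro ⟨i, j, k, l, h1, h2, h3, h4, h5, h6⟩
    refine ⟨![i, j, k, l], ?_, ?_⟩
    · intro a b hab
      fin_cases a <;> fin_cases b <;> simp at hab ⊢ <;>
        simp only [Fin.lt_def, Fin.le_def] <;> omega
    · intro a b
      fin_cases a <;> fin_cases b <;> simp <;>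
        simp only [Fin.lt_def, Fin.le_def] <;> omega

lemma patt2 {n : ℕ} (σ : Equiv.Perm (Fin n)) :
    PattContains (σ : Fin n → Fin n) (![1, 2, 3, 0] : Fin 4 → Fin 4) ↔ W2 σ := by
  constructor
  · rintro ⟨f, hf, h⟩
    refine ⟨f 0, f 1, f 2, f 3, hf (by decide), hf (by decide), hf (by decide), ?_, ?_, ?_⟩
    · exact (h 0 1).1 (by decide)
    · exact (h 1 2).1 (by decide)
    · exact (h 3 0).1 (by decide)
  · rintro ⟨i, j, k, l, h1, h2, h3, h4, h5, h6⟩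
    refine ⟨![i, j, k, l], ?_, ?_⟩
    · intro a b hab
      fin_cases a <;> fin_cases b <;> simp at hab ⊢ <;>
        simp only [Fin.lt_def, Fin.le_def] <;> omega
    · intro a b
      fin_cases a <;> fin_cases b <;> simp <;>
        simp only [Fin.lt_def, Fin.le_def] <;> omega

/-- Site `u` of the extended permutation, seen in the old one. -/
def dfl (p u : ℕ) : ℕ := if u ≤ p then u else u - 1

lemma Q_ext {n : ℕ} (p : Fin (n + 1)) (σ : Equiv.Perm (Fin n)) (u v : ℕ) :
    Q (ext p σ) u v ↔ Q σ (dfl p u) (dfl p v) ∨ (u < p.val ∧ p.val < v) := by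
  constructor
  · rintro ⟨i, j, h⟩
    induction i using Fin.lastCases with
    | last => have := j.isLt; simp only [Fin.val_last] at h; omega
    | cast i =>
      induction j using Fin.lastCases with
      | last =>
        right
        simp only [ext_castSucc_val, ext_last] at h
        split_ifs at h <;> omega
      | cast j =>
        left
        simp only [ext_castSucc_val, Fin.val_castSucc] at h
        refine ⟨i, j, ?_⟩
        unfold dfl
        split_ifs at h ⊢ <;> omega
  · rintro (⟨i, j, h⟩ | h)
    · refine ⟨i.castSucc, j.castSucc, ?_⟩
      simp only [ext_castSucc_val, Fin.val_castSucc]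
      unfold dfl at h
      split_ifs at h ⊢ <;> omega
    · have hp := p.isLt
      refine ⟨(σ.symm ⟨u, by omega⟩).castSucc, Fin.last n, ?_⟩
      simp only [ext_castSucc_val, ext_last, Fin.val_castSucc, Fin.val_last,
        Equiv.apply_symm_apply]
      refine ⟨Fin.isLt _, ?_⟩
      split_ifs <;> omega

lemma R_ext {n : ℕ} (p : Fin (n + 1)) (σ : Equiv.Perm (Fin n)) (u v : ℕ) :
    R (ext p σ) u v ↔ R σ (dfl p u) (dfl p v) ∨ (p.val < v ∧ Q σ (dfl p u) p.val) := by
  constructor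
  · rintro ⟨i, j, k, h⟩
    induction i using Fin.lastCases with
    | last => have := j.isLt; simp only [Fin.val_last] at h; omega
    | cast i =>
      induction j using Fin.lastCases with
      | last => have := k.isLt; simp only [Fin.val_last] at h; omega
      | cast j =>
        induction k using Fin.lastCases with
        | last =>
          right
          simp only [ext_castSucc_val, ext_last, Fin.val_castSucc] at h
          refine ⟨by omega, i, j, ?_⟩
          unfold dfl
          split_ifs at h ⊢ <;> omega
        | cast k =>
          left
          simp only [ext_castSucc_val, Fin.val_castSucc] at h
          refine ⟨i, j, k, ?_⟩
          unfold dfl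
          split_ifs at h ⊢ <;> omega
  · rintro (⟨i, j, k, h⟩ | ⟨hv, i, j, h⟩)
    · refine ⟨i.castSucc, j.castSucc, k.castSucc, ?_⟩
      simp only [ext_castSucc_val, Fin.val_castSucc]
      unfold dfl at h
      split_ifs at h ⊢ <;> omega
    · refine ⟨i.castSucc, j.castSucc, Fin.last n, ?_⟩
      simp only [ext_castSucc_val, ext_last, Fin.val_castSucc, Fin.val_last]
      have := j.isLt
      unfold dfl at h
      split_ifs at h ⊢ <;> omega

lemma W1_ext {n : ℕ} (p : Fin (n + 1)) (σ : Equiv.Perm (Fin n)) :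
    W1 (ext p σ) ↔ W1 σ ∨ R σ 0 p.val := by
  constructor
  · rintro ⟨i, j, k, l, h⟩
    have h1 : i.val < n := by have := l.isLt; omega
    have h2 : j.val < n := by have := l.isLt; omega
    have h3 : k.val < n := by have := l.isLt; omega
    obtain ⟨i, rfl⟩ : ∃ i' : Fin n, i = i'.castSucc := ⟨⟨i, h1⟩, rfl⟩
    obtain ⟨j, rfl⟩ : ∃ i' : Fin n, j = i'.castSucc := ⟨⟨j, h2⟩, rfl⟩
    obtain ⟨k, rfl⟩ : ∃ i' : Fin n, k = i'.castSucc := ⟨⟨k, h3⟩, rfl⟩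
    induction l using Fin.lastCases with
    | last =>
      right
      simp only [ext_castSucc_val, ext_last, Fin.val_castSucc] at h
      refine ⟨i, j, k, ?_⟩
      split_ifs at h <;> omega
    | cast l =>
      left
      simp only [ext_castSucc_val, Fin.val_castSucc] at h
      refine ⟨i, j, k, l, ?_⟩
      split_ifs at h <;> omega
  · rintro (⟨i, j, k, l, h⟩ | ⟨i, j, k, h⟩)
    · refine ⟨i.castSucc, j.castSucc, k.castSucc, l.castSucc, ?_⟩
      simp only [ext_castSucc_val, Fin.val_castSucc]
      split_ifs <;> omega
    · refine ⟨i.castSucc, j.castSucc, k.castSucc, Fin.last n, ?_⟩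
      simp only [ext_castSucc_val, ext_last, Fin.val_castSucc, Fin.val_last]
      have := k.isLt
      split_ifs <;> omega

lemma W2_ext {n : ℕ} (p : Fin (n + 1)) (σ : Equiv.Perm (Fin n)) :
    W2 (ext p σ) ↔ W2 σ ∨ R σ p.val n := by
  constructor
  · rintro ⟨i, j, k, l, h⟩
    have h1 : i.val < n := by have := l.isLt; omega
    have h2 : j.val < n := by have := l.isLt; omega
    have h3 : k.val < n := by have := l.isLt; omega
    obtain ⟨i, rfl⟩ : ∃ i' : Fin n, i = i'.castSucc := ⟨⟨i, h1⟩, rfl⟩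
    obtain ⟨j, rfl⟩ : ∃ i' : Fin n, j = i'.castSucc := ⟨⟨j, h2⟩, rfl⟩
    obtain ⟨k, rfl⟩ : ∃ i' : Fin n, k = i'.castSucc := ⟨⟨k, h3⟩, rfl⟩
    induction l using Fin.lastCases with
    | last =>
      right
      simp only [ext_castSucc_val, ext_last, Fin.val_castSucc] at h
      have := (σ k).isLt
      refine ⟨i, j, k, ?_⟩
      split_ifs at h <;> omega
    | cast l =>
      left
      simp only [ext_castSucc_val, Fin.val_castSucc] at h
      refine ⟨i, j, k, l, ?_⟩
      split_ifs at h <;> omega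
  · rintro (⟨i, j, k, l, h⟩ | ⟨i, j, k, h⟩)
    · refine ⟨i.castSucc, j.castSucc, k.castSucc, l.castSucc, ?_⟩
      simp only [ext_castSucc_val, Fin.val_castSucc]
      split_ifs <;> omega
    · refine ⟨i.castSucc, j.castSucc, k.castSucc, Fin.last n, ?_⟩
      simp only [ext_castSucc_val, ext_last, Fin.val_castSucc, Fin.val_last]
      have := k.isLt
      split_ifs <;> omega

open Classical in
/-- Number of avoiding extensions by `l` further entries. -/
noncomputable def cnt : ℕ → (n : ℕ) → Equiv.Perm (Fin n) → ℕ
  | 0, _, _ => 1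
  | l + 1, n, σ => ∑ p : Fin (n + 1),
      if R σ 0 p.val ∨ R σ p.val n then 0 else cnt l (n + 1) (ext p σ)

open Classical in
lemma avF_eq_sum (n : ℕ) :
    avF n = ∑ σ : Equiv.Perm (Fin n), if W1 σ ∨ W2 σ then 0 else 1 := by
  unfold avF PattAvoids
  rw [Nat.card_eq_fintype_card, Fintype.card_subtype, Finset.card_filter]
  refine Finset.sum_congr rfl fun σ _ => ?_
  rw [patt1, patt2]
  by_cases h1 : W1 σ <;> by_cases h2 : W2 σ <;> simp [h1, h2]

open Classical in
lemma sum_cnt (l : ℕ) : ∀ n m : ℕ, n + l = m →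
    (∑ σ : Equiv.Perm (Fin n), if W1 σ ∨ W2 σ then 0 else cnt l n σ) = avF m := by
  induction l with
  | zero =>
    rintro n m rfl
    rw [avF_eq_sum]
    rfl
  | succ l ih =>
    intro n m h
    rw [← ih (n + 1) m (by omega)]
    rw [← (ext_bij n).sum_comp (fun σ => if W1 σ ∨ W2 σ then 0 else cnt l (n + 1) σ)]
    rw [Fintype.sum_prod_type_right]
    refine Finset.sum_congr rfl fun σ _ => ?_
    simp only [W1_ext, W2_ext, cnt]
    by_cases h : W1 σ ∨ W2 σ
    · rw [if_pos h, Finset.sum_eq_zero]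
      intro p _
      rw [if_pos]
      tauto
    · rw [if_neg h]
      refine Finset.sum_congr rfl fun p _ => ?_
      congr 1
      apply propext
      tauto

lemma avF_eq_cnt (n : ℕ) : avF n = cnt n 0 1 := by
  rw [← sum_cnt n 0 n (by omega)]
  rw [Fintype.sum_unique]
  rw [if_neg]
  · congr 1
  · rintro (⟨i, _⟩ | ⟨i, _⟩) <;> exact i.elim0

/-! ### The recursions -/

def P0 : ℕ → ℕ → ℕ
  | 0, _ => 1
  | l + 1, k => P0 l (k + 1) + ∑ j ∈ range k, P0 l (j + 1)

def P1 : ℕ → ℕ → ℕ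
  | 0, _ => 1
  | l + 1, k => ∑ j ∈ range (k + 1), P1 l j

def H : ℕ → ℕ → ℕ → ℕ
  | 0, _, _ => 0
  | l + 1, b, e => H l (b + 1) e + H l b e + ∑ p ∈ range b, H l p e + ∑ k ∈ range e, P1 l (k + 1)

def G : ℕ → ℕ → ℕ → ℕ
  | 0, _, _ => 1
  | l + 1, b, d => G l (b + 1) d + G l b (d + 1) +
      ∑ p ∈ range b, (G l p (b - p + 1) + H l p d) + ∑ k ∈ range d, P0 l (k + 1)

def D : ℕ → ℕ → ℕ
  | 0, _ => 1
  | l + 1, n => D l (n + 1) + ∑ p ∈ range n, G l p (n - p)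

lemma cnt_succ {l n : ℕ} {σ : Equiv.Perm (Fin n)} (t : ℕ → ℕ)
    (ht : ∀ p : Fin (n + 1), R σ 0 p.val ∨ R σ p.val n → t p.val = 0)
    (ht' : ∀ p : Fin (n + 1), ¬ R σ 0 p.val → ¬ R σ p.val n →
      cnt l (n + 1) (ext p σ) = t p.val) :
    cnt (l + 1) n σ = ∑ p ∈ range (n + 1), t p := by
  rw [Finset.sum_range]
  simp only [cnt]
  refine Finset.sum_congr rfl fun p _ => ?_
  split_ifs with h
  · exact (ht p h).symm
  · push Not at h
    exact ht' p h.1 h.2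

/-- After the first 123, with a 12 below the whole window. -/
structure Inv1 {n : ℕ} (σ : Equiv.Perm (Fin n)) (a k : ℕ) : Prop where
  le : a + k ≤ n
  r0 : ∀ v ≤ n, R σ 0 v ↔ a + k < v
  rn : ∀ u, R σ u n ↔ u < a
  q : ∀ u v, a ≤ u → v ≤ a + k → ¬ Q σ u v
  q0 : ∀ v, a ≤ v → v ≤ a + k → Q σ 0 v

/-- After the first 123, with no 12 below the window. -/
structure Inv0 {n : ℕ} (σ : Equiv.Perm (Fin n)) (a k : ℕ) : Prop where
  pos : 0 < a
  le : a + k ≤ n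
  r0 : ∀ v ≤ n, R σ 0 v ↔ a + k < v
  rn : ∀ u, R σ u n ↔ u < a
  q : ∀ u v, a ≤ u → v ≤ a + k → ¬ Q σ u v
  q0 : ∀ v, a ≤ v → v ≤ a + k → (Q σ 0 v ↔ a < v)

lemma Q.mono {n : ℕ} {σ : Equiv.Perm (Fin n)} {u v u' v' : ℕ} (h : Q σ u v) (hu : u' ≤ u)
    (hv : v ≤ v') : Q σ u' v' := by
  obtain ⟨i, j, h⟩ := h
  exact ⟨i, j, by omega⟩

lemma dfl_zero (p : ℕ) : dfl p 0 = 0 := by simp [dfl]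
lemma dfl_le {p u : ℕ} (h : u ≤ p) : dfl p u = u := by simp [dfl, h]
lemma dfl_gt {p u : ℕ} (h : p < u) : dfl p u = u - 1 := by
  unfold dfl; rw [if_neg]; omega

lemma Inv1.step {n : ℕ} {σ : Equiv.Perm (Fin n)} {a k : ℕ} (h : Inv1 σ a k) (p : Fin (n + 1))
    (h1 : a ≤ p.val) (h2 : p.val ≤ a + k) : Inv1 (ext p σ) a (p.val - a) where
  le := by have := p.isLt; omega
  r0 := by
    intro v hv
    rw [R_ext, dfl_zero]
    have hq := h.q0 p h1 h2
    rcases le_or_gt v p.val with hp | hp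
    · rw [dfl_le hp, h.r0 v (by omega)]
      constructor
      · rintro (h | h) <;> omega
      · omega
    · have : a + (p.val - a) < v := by omega
      simp [hp, hq, this]
  rn := by
    intro u
    have hp := p.isLt
    rw [R_ext, dfl_gt hp, Nat.add_sub_cancel, h.rn]
    constructor
    · rintro (h' | ⟨_, h'⟩)
      · unfold dfl at h'; split_ifs at h' <;> omega
      · by_contra hu
        refine h.q _ _ ?_ h2 h'
        unfold dfl; split_ifs <;> omega
    · intro hu
      left; rw [dfl_le (by omega)]; exact hu
  q := by
    intro u v hu hv
    rw [Q_ext]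
    rintro (h' | h')
    · refine h.q _ _ ?_ ?_ h' <;> unfold dfl <;> split_ifs <;> omega
    · omega
  q0 := by
    intro v h3 h4
    rw [Q_ext]
    left
    rw [dfl_zero, dfl_le (by omega)]
    exact h.q0 _ h3 (by omega)

lemma Inv0.step {n : ℕ} {σ : Equiv.Perm (Fin n)} {a k : ℕ} (h : Inv0 σ a k) (p : Fin (n + 1))
    (h1 : a < p.val) (h2 : p.val ≤ a + k) : Inv0 (ext p σ) a (p.val - a) where
  pos := h.pos
  le := by have := p.isLt; omega
  r0 := by
    intro v hv
    rw [R_ext, dfl_zero]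
    have hq := (h.q0 p h1.le h2).2 h1
    rcases le_or_gt v p.val with hp | hp
    · rw [dfl_le hp, h.r0 v (by omega)]
      constructor
      · rintro (h | h) <;> omega
      · omega
    · have : a + (p.val - a) < v := by omega
      simp [hp, hq, this]
  rn := by
    intro u
    have hp := p.isLt
    rw [R_ext, dfl_gt hp, Nat.add_sub_cancel, h.rn]
    constructor
    · rintro (h' | ⟨_, h'⟩)
      · unfold dfl at h'; split_ifs at h' <;> omega
      · by_contra hu
        refine h.q _ _ ?_ h2 h'
        unfold dfl; split_ifs <;> omega
    · intro hu
      left; rw [dfl_le (by omega)]; exact hu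
  q := by
    intro u v hu hv
    rw [Q_ext]
    rintro (h' | h')
    · refine h.q _ _ ?_ ?_ h' <;> unfold dfl <;> split_ifs <;> omega
    · omega
  q0 := by
    intro v h3 h4
    rw [Q_ext, dfl_zero, dfl_le (by omega), h.q0 _ h3 (by omega)]
    omega

lemma Inv0.step' {n : ℕ} {σ : Equiv.Perm (Fin n)} {a k : ℕ} (h : Inv0 σ a k) (p : Fin (n + 1))
    (h1 : p.val = a) : Inv0 (ext p σ) a (k + 1) where
  pos := h.pos
  le := by have := h.le; omega
  r0 := by
    intro v hv
    have hle := h.le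
    have hq := h.q0 p h1.ge (by omega)
    have hq' : ¬ Q σ 0 p.val := by rw [hq]; omega
    rw [R_ext, dfl_zero]
    simp only [hq', and_false, or_false]
    unfold dfl
    split_ifs with hp
    · rw [h.r0 v (by omega)]; omega
    · rw [h.r0 _ (by omega)]; omega
  rn := by
    intro u
    have hp := p.isLt
    have hle := h.le
    have hq := h.q0 p h1.ge (by omega)
    have hq' : ¬ Q σ (dfl p u) p.val := by
      intro h'
      have := hq.1 (h'.mono (Nat.zero_le _) le_rfl)
      omega
    rw [R_ext, dfl_gt hp, Nat.add_sub_cancel, h.rn]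
    simp only [hq', and_false, or_false]
    unfold dfl; split_ifs <;> omega
  q := by
    intro u v hu hv
    rw [Q_ext]
    rintro (h' | h')
    · refine h.q _ _ ?_ ?_ h' <;> unfold dfl <;> split_ifs <;> omega
    · omega
  q0 := by
    intro v h3 h4
    have := h.pos
    rw [Q_ext, dfl_zero]
    rcases le_or_gt v p.val with hp | hp
    · rw [dfl_le hp, h.q0 _ h3 (by omega)]
      omega
    · have : 0 < p.val ∧ p.val < v := by omega
      simp only [this, and_self, or_true, true_iff]
      omega

lemma cnt_Inv1 (l : ℕ) : ∀ {n : ℕ} {σ : Equiv.Perm (Fin n)} {a k : ℕ}, Inv1 σ a k →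
    cnt l n σ = P1 l k := by
  induction l with
  | zero => intros; rfl
  | succ l ih =>
    intro n σ a k h
    have hle := h.le
    rw [cnt_succ (fun p => if a ≤ p ∧ p ≤ a + k then P1 l (p - a) else 0)]
    · rw [show n + 1 = a + (k + 1 + (n - a - k)) by omega, Finset.sum_range_add,
        Finset.sum_range_add, Finset.sum_eq_zero, zero_add]
      · conv_rhs => rw [← add_zero (P1 _ _)]
        congr 1
        · simp only [P1]
          refine Finset.sum_congr rfl fun j hj => ?_
          rw [Finset.mem_range] at hj
          rw [if_pos (by omega)]
          congr 1; omega
        · refine Finset.sum_eq_zero fun j hj => ?_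
          rw [if_neg (by omega)]
      · intro j hj
        rw [Finset.mem_range] at hj
        rw [if_neg (by omega)]
    · intro p hp
      have := p.isLt
      rw [h.r0 _ (by omega), h.rn] at hp
      rw [if_neg (by omega)]
    · intro p h1 h2
      have := p.isLt
      rw [h.r0 _ (by omega)] at h1
      rw [h.rn] at h2
      rw [if_pos (by omega)]
      exact ih (h.step p (by omega) (by omega))

lemma cnt_Inv0 (l : ℕ) : ∀ {n : ℕ} {σ : Equiv.Perm (Fin n)} {a k : ℕ}, Inv0 σ a k →
    cnt l n σ = P0 l k := by
  induction l with
  | zero => intros; rfl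
  | succ l ih =>
    intro n σ a k h
    have hle := h.le
    rw [cnt_succ (fun p => if p = a then P0 l (k + 1) else
      if a ≤ p ∧ p ≤ a + k then P0 l (p - a) else 0)]
    · rw [show n + 1 = a + (1 + (k + (n - a - k))) by omega, Finset.sum_range_add,
        Finset.sum_range_add, Finset.sum_range_add, Finset.sum_eq_zero, zero_add]
      · simp only [P0]
        congr 1
        · simp
        conv_rhs => rw [← add_zero (∑ j ∈ range k, _)]
        congr 1
        · refine Finset.sum_congr rfl fun j hj => ?_
          rw [Finset.mem_range] at hj
          rw [if_neg (by omega), if_pos (by omega)]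
          congr 1; omega
        · refine Finset.sum_eq_zero fun j hj => ?_
          rw [if_neg (by omega), if_neg (by omega)]
      · intro j hj
        rw [Finset.mem_range] at hj
        rw [if_neg (by omega), if_neg (by omega)]
    · intro p hp
      have := p.isLt
      rw [h.r0 _ (by omega), h.rn] at hp
      rw [if_neg (by omega), if_neg (by omega)]
    · intro p h1 h2
      have := p.isLt
      rw [h.r0 _ (by omega)] at h1
      rw [h.rn] at h2
      split_ifs with h3 h4
      · exact ih (h.step' p h3)
      · exact ih (h.step p (by omega) (by omega))
      · omega

/-! ### Permutations with no 123 -/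

/-- Starting points and lengths of consecutive blocks. -/
def bsp : ℕ → List ℕ → List (ℕ × ℕ)
  | _, [] => []
  | c, e :: L => (c, e) :: bsp (c + e) L

lemma bsp_ge (L : List ℕ) : ∀ c x, x ∈ bsp c L → c ≤ x.1 ∧ x.1 + x.2 ≤ c + L.sum := by
  induction L with
  | nil => simp [bsp]
  | cons e L ih =>
    intro c x hx
    simp only [bsp, List.mem_cons] at hx
    rw [List.sum_cons]
    rcases hx with rfl | hx
    · simp only; omega
    · have := ih _ _ hx; omega

lemma bsp_sep (L : List ℕ) : ∀ c x y, x ∈ bsp c L → y ∈ bsp c L →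
    y.1 ≤ x.1 ∨ x.1 + x.2 ≤ y.1 := by
  induction L with
  | nil => simp [bsp]
  | cons e L ih =>
    intro c x y hx hy
    simp only [bsp, List.mem_cons] at hx hy
    rcases hx with rfl | hx <;> rcases hy with rfl | hy
    · simp
    · right; exact (bsp_ge _ _ _ hy).1
    · left; have := (bsp_ge _ _ _ hx).1; simp only; omega
    · exact ih _ _ _ hx hy

lemma bsp_shift (L : List ℕ) : ∀ c x, x ∈ bsp (c + 1) L ↔ ∃ y ∈ bsp c L, x = (y.1 + 1, y.2) := by
  induction L with
  | nil => simp [bsp]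
  | cons e L ih =>
    intro c x
    simp only [bsp, List.mem_cons]
    rw [show c + 1 + e = c + e + 1 by omega, ih]
    simp

/-- `Q` relative to the blocks. -/
def BQ (c : ℕ) (L : List ℕ) (u v : ℕ) : Prop := ∃ x ∈ bsp c L, u ≤ x.1 ∧ x.1 + 2 ≤ v

lemma BQ_cons (c e : ℕ) (L : List ℕ) (u v : ℕ) :
    BQ c (e :: L) u v ↔ (u ≤ c ∧ c + 2 ≤ v) ∨ BQ (c + e) L u v := by
  simp [BQ, bsp]

lemma BQ_shift (c : ℕ) (L : List ℕ) (u v : ℕ) :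
    BQ (c + 1) L u v ↔ BQ c L (u - 1) (v - 1) := by
  unfold BQ
  constructor
  · rintro ⟨x, hx, h⟩
    obtain ⟨y, hy, rfl⟩ := (bsp_shift _ _ _).1 hx
    exact ⟨y, hy, by simp only at h; omega⟩
  · rintro ⟨y, hy, h⟩
    exact ⟨_, (bsp_shift _ _ _).2 ⟨y, hy, rfl⟩, by simp only; omega⟩

lemma BQ_low (c : ℕ) (L : List ℕ) (u u' v : ℕ) (hu : u ≤ c) (hu' : u' ≤ c) :
    BQ c L u v ↔ BQ c L u' v := by
  unfold BQ
  constructor <;> rintro ⟨x, hx, h⟩ <;> refine ⟨x, hx, ?_⟩ <;>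
    have := bsp_ge _ _ _ hx <;> omega

lemma BQ_false (c : ℕ) (L : List ℕ) (u v : ℕ) (hv : v ≤ c + 1) : ¬ BQ c L u v := by
  rintro ⟨x, hx, h⟩
  have := bsp_ge _ _ _ hx
  omega

/-- Shifting blocks above the inserted value. -/
lemma BQ_dfl (c : ℕ) (L : List ℕ) (p u v : ℕ) (hp : p ≤ c) :
    BQ (c + 1) L u v ↔ BQ c L (dfl p u) (dfl p v) := by
  rw [BQ_shift]
  unfold BQ dfl
  constructor <;> rintro ⟨x, hx, h⟩ <;> refine ⟨x, hx, ?_⟩ <;>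
    have := bsp_ge _ _ _ hx <;> split_ifs at * <;> omega

structure InvA {n : ℕ} (σ : Equiv.Perm (Fin n)) (b d : ℕ) (L : List ℕ) : Prop where
  pos : 0 < d
  size : n = b + d + L.sum + 1
  r : ∀ u v, ¬ R σ u v
  q : ∀ u v, v ≤ n → (Q σ u v ↔ BQ b (d :: L) u v)

structure InvD {n : ℕ} (σ : Equiv.Perm (Fin n)) : Prop where
  r : ∀ u v, ¬ R σ u v
  q : ∀ u v, ¬ Q σ u v

lemma InvD.zero {n : ℕ} {σ : Equiv.Perm (Fin n)} (h : InvD σ) (p : Fin (n + 1))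
    (hp : p.val = 0) : InvD (ext p σ) where
  r u v := by rw [R_ext]; simp [h.r, h.q]
  q u v := by rw [Q_ext]; simp [h.q, hp]

lemma InvD.succ {n : ℕ} {σ : Equiv.Perm (Fin n)} (h : InvD σ) (p : Fin (n + 1))
    (hp : 0 < p.val) : InvA (ext p σ) (p.val - 1) (n + 1 - p.val) [] where
  pos := by have := p.isLt; omega
  size := by have := p.isLt; simp only [List.sum_nil]; omega
  r u v := by rw [R_ext]; simp [h.r, h.q]
  q u v hv := by
    rw [Q_ext, BQ_cons]
    simp only [h.q, false_or, BQ, bsp, List.not_mem_nil, false_and, exists_false, or_false]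
    omega

lemma InvA.dfl_le' {n p v : ℕ} (hp : p < n + 1) (hv : v ≤ n + 1) : dfl p v ≤ n := by
  unfold dfl; split_ifs <;> omega

lemma InvA.r_ext {n : ℕ} {σ : Equiv.Perm (Fin n)} {b d : ℕ} {L : List ℕ} (h : InvA σ b d L)
    (p : Fin (n + 1)) (hp : p.val ≤ b + 1) (u v : ℕ) : ¬ R (ext p σ) u v := by
  have := p.isLt
  rw [R_ext, h.q _ _ (by omega)]
  rintro (h' | ⟨_, h'⟩)
  · exact h.r _ _ h'
  · exact BQ_false _ _ _ _ hp h'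

lemma InvA.zero {n : ℕ} {σ : Equiv.Perm (Fin n)} {b d : ℕ} {L : List ℕ} (h : InvA σ b d L)
    (p : Fin (n + 1)) (hp : p.val = 0) : InvA (ext p σ) (b + 1) d L where
  pos := h.pos
  size := by have := h.size; omega
  r := h.r_ext p (by omega)
  q u v hv := by
    rw [Q_ext, h.q _ _ (InvA.dfl_le' p.isLt hv), BQ_dfl _ _ p.val _ _ (by omega), hp]
    simp

lemma InvA.new {n : ℕ} {σ : Equiv.Perm (Fin n)} {b d : ℕ} {L : List ℕ} (h : InvA σ b d L)
    (p : Fin (n + 1)) (hp : 0 < p.val) (hp' : p.val ≤ b) :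
    InvA (ext p σ) (p.val - 1) (b + 2 - p.val) (d :: L) where
  pos := by omega
  size := by have := h.size; rw [List.sum_cons]; omega
  r := h.r_ext p (by omega)
  q u v hv := by
    rw [Q_ext, h.q _ _ (InvA.dfl_le' p.isLt hv), BQ_cons (p.val - 1),
      show p.val - 1 + (b + 2 - p.val) = b + 1 by omega, BQ_dfl _ _ p.val _ _ (by omega), or_comm]
    refine or_congr ?_ Iff.rfl
    omega

lemma InvA.rep {n : ℕ} {σ : Equiv.Perm (Fin n)} {b d : ℕ} {L : List ℕ} (h : InvA σ b d L)
    (p : Fin (n + 1)) (hp : p.val = b + 1) : InvA (ext p σ) b (d + 1) L where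
  pos := by omega
  size := by have := h.size; omega
  r := h.r_ext p (by omega)
  q u v hv := by
    have := h.pos
    rw [Q_ext, h.q _ _ (InvA.dfl_le' p.isLt hv), BQ_cons, BQ_cons,
      show b + (d + 1) = b + d + 1 by omega, BQ_dfl _ _ p.val _ _ (by omega)]
    have : (dfl p.val u ≤ b ∧ b + 2 ≤ dfl p.val v) ∨ (u < p.val ∧ p.val < v) ↔
        u ≤ b ∧ b + 2 ≤ v := by
      unfold dfl; split_ifs <;> omega
    rw [← this]
    tauto

lemma InvA.allrest {n : ℕ} {σ : Equiv.Perm (Fin n)} {b d : ℕ} {L : List ℕ} (h : InvA σ b d L)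
    (p : Fin (n + 1)) (g e k : ℕ) (hg : (g, e) ∈ bsp b (d :: L)) (hk : k < e)
    (hp : p.val = g + 2 + k) :
    (∀ v ≤ n + 1, R (ext p σ) 0 v ↔ g + 1 + (k + 1) < v) ∧
    (∀ u, R (ext p σ) u (n + 1) ↔ u < g + 1) ∧
    (∀ u v, g + 1 ≤ u → v ≤ g + 1 + (k + 1) → ¬ Q (ext p σ) u v) := by
  have hpl := p.isLt
  have key : ∀ u v, v ≤ p.val → BQ b (d :: L) u v → u ≤ g := by
    rintro u v hv ⟨x, hx, h1, h2⟩
    have := bsp_sep _ _ _ _ hg hx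
    simp only at this
    omega
  have key' : ∀ u, u ≤ g → BQ b (d :: L) u p.val := fun u hu =>
    ⟨_, hg, hu, by simp only; omega⟩
  refine ⟨?_, ?_, ?_⟩
  · intro v hv
    rw [R_ext, dfl_zero, h.q _ _ (by omega)]
    have := key' 0 (Nat.zero_le _)
    have h0 := h.r 0 (dfl p v)
    constructor
    · rintro (h' | h')
      · exact absurd h' h0
      · omega
    · intro h'
      exact Or.inr ⟨by omega, this⟩
  · intro u
    rw [R_ext, h.q _ _ (by omega)]
    constructor
    · rintro (h' | ⟨_, h'⟩)
      · exact absurd h' (h.r _ _)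
      · have := key _ _ le_rfl h'
        unfold dfl at this; split_ifs at this <;> omega
    · intro hu
      right
      rw [dfl_le (by omega)]
      exact ⟨hpl, key' _ (by omega)⟩
  · intro u v hu hv
    rw [Q_ext, dfl_le (show v ≤ p.val by omega), h.q _ _ (by omega)]
    rintro (h' | h')
    · have := key _ _ (by omega) h'
      unfold dfl at this; split_ifs at this <;> omega
    · omega

lemma InvA.head {n : ℕ} {σ : Equiv.Perm (Fin n)} {b d : ℕ} {L : List ℕ} (h : InvA σ b d L)
    (p : Fin (n + 1)) (k : ℕ) (hk : k < d) (hp : p.val = b + 2 + k) :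
    Inv0 (ext p σ) (b + 1) (k + 1) := by
  have hpl := p.isLt
  obtain ⟨h1, h2, h3⟩ := h.allrest p b d k (by simp [bsp]) hk hp
  refine ⟨by omega, by omega, h1, h2, h3, ?_⟩
  intro v hv hv'
  rw [Q_ext, dfl_zero, dfl_le (by omega), h.q _ _ (by omega), BQ_cons]
  have := BQ_false (b + d) L 0 v
  constructor
  · rintro ((h' | h') | h')
    · omega
    · by_contra hh
      exact this (by omega) h'
    · omega
  · intro h'
    left; left; omega

lemma InvA.tail {n : ℕ} {σ : Equiv.Perm (Fin n)} {b d : ℕ} {L : List ℕ} (h : InvA σ b d L)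
    (p : Fin (n + 1)) (g e k : ℕ) (hg : (g, e) ∈ bsp (b + d) L) (hk : k < e)
    (hp : p.val = g + 2 + k) :
    Inv1 (ext p σ) (g + 1) (k + 1) := by
  have hpl := p.isLt
  have hd := h.pos
  obtain ⟨h1, h2, h3⟩ := h.allrest p g e k (by simp [bsp, hg]) hk hp
  refine ⟨by omega, h1, h2, h3, ?_⟩
  intro v hv hv'
  have := bsp_ge _ _ _ hg
  simp only at this
  rw [Q_ext, dfl_zero, dfl_le (by omega), h.q _ _ (by omega), BQ_cons]
  left; left; omega

lemma sum_blocks (f h : ℕ → ℕ) (L : List ℕ) : ∀ c,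
    (∀ g e k, (g, e) ∈ bsp c L → k < e → f (g + 2 + k) = h (k + 1)) →
    ∑ i ∈ range L.sum, f (c + 2 + i) = (L.map fun e => ∑ k ∈ range e, h (k + 1)).sum := by
  induction L with
  | nil => simp
  | cons e L ih =>
    intro c hf
    rw [List.sum_cons, Finset.sum_range_add, List.map_cons, List.sum_cons, ← ih (c + e)]
    · congr 1
      · refine Finset.sum_congr rfl fun k hk => ?_
        rw [Finset.mem_range] at hk
        exact hf c e k (by simp [bsp]) hk
      · refine Finset.sum_congr rfl fun k hk => ?_
        congr 1; omega
    · intro g e' k hg hk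
      exact hf g e' k (by simp [bsp, hg]) hk

open Classical in
lemma cnt_succ_noR {l n : ℕ} {σ : Equiv.Perm (Fin n)} (hr : ∀ u v, ¬ R σ u v) :
    cnt (l + 1) n σ = ∑ p ∈ range (n + 1),
      if h : p < n + 1 then cnt l (n + 1) (ext ⟨p, h⟩ σ) else 0 := by
  apply cnt_succ (fun p => if h : p < n + 1 then cnt l (n + 1) (ext ⟨p, h⟩ σ) else 0)
  · rintro p (h | h) <;> exact absurd h (hr _ _)
  · intro p _ _
    rw [dif_pos p.isLt]

lemma cnt_InvA (l : ℕ) : ∀ {n : ℕ} {σ : Equiv.Perm (Fin n)} {b d : ℕ} {L : List ℕ},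
    InvA σ b d L → cnt l n σ = G l b d + (L.map fun e => H l b e).sum := by
  induction l with
  | zero => intros; simp [cnt, G, H]
  | succ l ih =>
    intro n σ b d L h
    rw [cnt_succ_noR h.r]
    generalize hf : (fun p : ℕ => if h : p < n + 1 then cnt l (n + 1) (ext ⟨p, h⟩ σ) else 0) = f
    have hs := h.size
    have e0 : f 0 = G l (b + 1) d + (L.map fun e => H l (b + 1) e).sum := by
      rw [← hf]; simp only; rw [dif_pos (by omega)]
      exact ih (h.zero _ rfl)
    have e1 : ∀ p < b, f (1 + p) = G l p (b - p + 1) + H l p d + (L.map fun e => H l p e).sum := by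
      intro p hp
      rw [← hf]; simp only; rw [dif_pos (by omega)]
      have := ih (h.new ⟨1 + p, by omega⟩ (by simp only; omega) (by simp only; omega))
      simp only at this
      rw [this, show 1 + p - 1 = p by omega, show b + 2 - (1 + p) = b - p + 1 by omega,
        List.map_cons, List.sum_cons, add_assoc]
    have e2 : f (1 + b) = G l b (d + 1) + (L.map fun e => H l b e).sum := by
      rw [← hf]; simp only; rw [dif_pos (by omega)]
      exact ih (h.rep _ (by simp only; omega))
    have e3 : ∀ k < d, f (b + 2 + k) = P0 l (k + 1) := by
      intro k hk
      rw [← hf]; simp only; rw [dif_pos (by omega)]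
      exact cnt_Inv0 l (h.head _ k hk rfl)
    have e4 := sum_blocks f (P1 l) L (b + d) (by
      intro g e k hg hk
      have := bsp_ge _ _ _ hg
      simp only at this
      rw [← hf]; simp only; rw [dif_pos (by omega)]
      exact cnt_Inv1 l (h.tail _ g e k hg hk rfl))
    have split : ∑ p ∈ range (n + 1), f p = f 0 + ∑ p ∈ range b, f (1 + p) + f (1 + b) +
        ∑ k ∈ range d, f (b + 2 + k) + ∑ i ∈ range L.sum, f (b + d + 2 + i) := by
      rw [show n + 1 = 1 + b + 1 + d + L.sum by omega, Finset.sum_range_add,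
        Finset.sum_range_add, Finset.sum_range_succ, Finset.sum_range_add]
      simp only [Finset.sum_range_one]
      congr 1
      · congr 1
        refine Finset.sum_congr rfl fun k _ => ?_
        congr 1; omega
      · refine Finset.sum_congr rfl fun k _ => ?_
        congr 1; omega
    rw [split, e0, e2, e4, Finset.sum_congr rfl (fun p hp => e1 p (Finset.mem_range.1 hp)),
      Finset.sum_congr rfl (fun k hk => e3 k (Finset.mem_range.1 hk))]
    have hL : (L.map fun e => H (l + 1) b e).sum = (L.map fun e => H l (b + 1) e).sum +
        (L.map fun e => H l b e).sum + ∑ p ∈ range b, (L.map fun e => H l p e).sum +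
        (L.map fun e => ∑ k ∈ range e, P1 l (k + 1)).sum := by
      clear * -
      induction L with
      | nil => simp
      | cons e L ih =>
        simp only [List.map_cons, List.sum_cons, Finset.sum_add_distrib]
        rw [ih, H]
        ring
    rw [hL]
    simp only [G, Finset.sum_add_distrib]
    ring

lemma cnt_InvD (l : ℕ) : ∀ {n : ℕ} {σ : Equiv.Perm (Fin n)}, InvD σ → cnt l n σ = D l n := by
  induction l with
  | zero => intros; rfl
  | succ l ih =>
    intro n σ h
    rw [cnt_succ_noR h.r, Finset.sum_range_succ', add_comm]
    simp only [D]
    congr 1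
    · rw [dif_pos (by omega)]
      exact ih (h.zero _ rfl)
    · refine Finset.sum_congr rfl fun p hp => ?_
      rw [Finset.mem_range] at hp
      rw [dif_pos (by omega), cnt_InvA l (h.succ _ (by simp))]
      simp

lemma avF_eq (n : ℕ) : avF n = D n 0 := by
  rw [avF_eq_cnt]
  refine cnt_InvD n ⟨?_, ?_⟩
  · rintro u v ⟨i, _⟩; exact i.elim0
  · rintro u v ⟨i, _⟩; exact i.elim0

/-! ### Evaluation with tables

The definitions below evaluate the recursion layer by layer; `force` makes sure that each table
entry is computed only once when the kernel evaluates the program. -/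

def force (x : ℕ) (f : ℕ → ℕ) : ℕ := Nat.rec (f 0) (fun n _ => f (n + 1)) x

lemma force_eq (x : ℕ) (f : ℕ → ℕ) : force x f = f x := by cases x <;> rfl

def tabl (f : ℕ → ℕ) : ℕ → ℕ → List ℕ
  | 0, _ => []
  | n + 1, i => f i :: tabl f n (i + 1)

def ctab (f : ℕ → ℕ) : ℕ → ℕ → (List ℕ → ℕ) → ℕ
  | 0, _, k => k []
  | n + 1, i, k => force (f i) fun a => ctab f n (i + 1) fun L => k (a :: L)

lemma ctab_eq (f : ℕ → ℕ) (n : ℕ) : ∀ i k, ctab f n i k = k (tabl f n i) := by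
  induction n with
  | zero => intros; rfl
  | succ n ih => intro i k; simp only [ctab, force_eq, ih, tabl]

def lk : List ℕ → ℕ → ℕ → ℕ
  | [], _, z => z
  | a :: _, 0, _ => a
  | _ :: L, j + 1, z => lk L j z

lemma lk_tabl (f : ℕ → ℕ) (n : ℕ) : ∀ i j, lk (tabl f n i) j (f (i + j)) = f (i + j) := by
  induction n with
  | zero => intros; rfl
  | succ n ih =>
    intro i j
    cases j with
    | zero => rfl
    | succ j =>
      have := ih (i + 1) j
      rw [show i + 1 + j = i + (j + 1) by omega] at this
      exact this

def memo1 (n : ℕ) (f : ℕ → ℕ) (k : (ℕ → ℕ) → ℕ) : ℕ :=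
  ctab f n 0 fun L => k fun j => lk L j (f j)

lemma memo1_eq (n : ℕ) (f : ℕ → ℕ) (k : (ℕ → ℕ) → ℕ) : memo1 n f k = k f := by
  unfold memo1
  rw [ctab_eq]
  congr 1
  funext j
  have := lk_tabl f n 0 j
  rwa [Nat.zero_add] at this

def tabl2 (f : ℕ → ℕ → ℕ) : ℕ → ℕ → List (List ℕ)
  | 0, _ => []
  | n + 1, i => tabl (f i) (n + 1) 0 :: tabl2 f n (i + 1)

def ctab2 (f : ℕ → ℕ → ℕ) : ℕ → ℕ → (List (List ℕ) → ℕ) → ℕ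
  | 0, _, k => k []
  | n + 1, i, k => ctab (f i) (n + 1) 0 fun R => ctab2 f n (i + 1) fun L => k (R :: L)

lemma ctab2_eq (f : ℕ → ℕ → ℕ) (n : ℕ) : ∀ i k, ctab2 f n i k = k (tabl2 f n i) := by
  induction n with
  | zero => intros; rfl
  | succ n ih => intro i k; simp only [ctab2, ctab_eq, ih, tabl2]

def lk2 : List (List ℕ) → ℕ → ℕ → ℕ → ℕ
  | [], _, _, z => z
  | R :: _, 0, d, z => lk R d z
  | _ :: L, j + 1, d, z => lk2 L j d z

lemma lk2_tabl2 (f : ℕ → ℕ → ℕ) (n : ℕ) : ∀ i j d,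
    lk2 (tabl2 f n i) j d (f (i + j) d) = f (i + j) d := by
  induction n with
  | zero => intros; rfl
  | succ n ih =>
    intro i j d
    cases j with
    | zero =>
      have := lk_tabl (f i) (n + 1) 0 d
      rw [Nat.zero_add] at this
      exact this
    | succ j =>
      have := ih (i + 1) j d
      rw [show i + 1 + j = i + (j + 1) by omega] at this
      exact this

def memo2 (n : ℕ) (f : ℕ → ℕ → ℕ) (k : (ℕ → ℕ → ℕ) → ℕ) : ℕ :=
  ctab2 f n 0 fun L => k fun b d => lk2 L b d (f b d)

lemma memo2_eq (n : ℕ) (f : ℕ → ℕ → ℕ) (k : (ℕ → ℕ → ℕ) → ℕ) : memo2 n f k = k f := by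
  unfold memo2
  rw [ctab2_eq]
  congr 1
  funext b d
  have := lk2_tabl2 f n 0 b d
  rwa [Nat.zero_add] at this

def sumTo (f : ℕ → ℕ) : ℕ → ℕ
  | 0 => 0
  | n + 1 => sumTo f n + f n

lemma sumTo_eq (f : ℕ → ℕ) (n : ℕ) : sumTo f n = ∑ i ∈ range n, f i := by
  induction n with
  | zero => rfl
  | succ n ih => rw [Finset.sum_range_succ, ← ih]; rfl

def loop : ℕ → (ℕ → ℕ) → (ℕ → ℕ) → (ℕ → ℕ → ℕ) → (ℕ → ℕ → ℕ) → (ℕ → ℕ) → ℕ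
  | 0, _, _, _, _, dd => dd 0
  | s + 1, p0, p1, h, g, dd =>
    memo1 (s + 2) (fun k => p0 (k + 1) + sumTo (fun j => p0 (j + 1)) k) fun p0' =>
    memo1 (s + 2) (fun k => sumTo p1 (k + 1)) fun p1' =>
    memo2 (s + 2) (fun b e => h (b + 1) e + h b e + sumTo (fun p => h p e) b +
      sumTo (fun k => p1 (k + 1)) e) fun h' =>
    memo2 (s + 2) (fun b d => g (b + 1) d + g b (d + 1) +
      sumTo (fun p => g p (b - p + 1) + h p d) b + sumTo (fun k => p0 (k + 1)) d) fun g' =>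
    memo1 (s + 2) (fun n => dd (n + 1) + sumTo (fun p => g p (n - p)) n) fun dd' =>
    loop s p0' p1' h' g' dd'

lemma loop_eq (s : ℕ) : ∀ l, loop s (P0 l) (P1 l) (H l) (G l) (D l) = D (l + s) 0 := by
  induction s with
  | zero => intro l; rfl
  | succ s ih =>
    intro l
    rw [show l + (s + 1) = l + 1 + s by omega, ← ih (l + 1)]
    simp only [loop, memo1_eq, memo2_eq, sumTo_eq]
    rfl

def tableValue (n : ℕ) : ℕ :=
  loop n (fun _ => 1) (fun _ => 1) (fun _ _ => 0) (fun _ _ => 1) (fun _ => 1)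

lemma avF_eq_tableValue (n : ℕ) : avF n = tableValue n := by
  rw [avF_eq, ← Nat.zero_add n, ← loop_eq, Nat.zero_add]
  rfl

end AvProof

open AvProof in
theorem av_1234_2341_initial_terms :
    avF 1 = 1 ∧ avF 2 = 2 ∧ avF 3 = 6 ∧ avF 4 = 22 ∧ avF 5 = 89 ∧ avF 6 = 376 ∧
    avF 7 = 1611 ∧ avF 8 = 6901 ∧ avF 9 = 29375 ∧ avF 10 = 123996 ∧
    avF 11 = 518971 ∧ avF 12 = 2155145 := by
  simp only [avF_eq_tableValue]
  decide +kernel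
end

section
/- The number of permutations of length n (for n = 1,...,12) avoiding both patterns 1243 and 2314 is respectively 1, 2, 6, 22, 88, 367, 1571, 6861, 30468, 137229, 625573, 2881230. -/
/-- The number of permutations of length n avoiding both 1243 and 2314. -/
noncomputable def avE (n : ℕ) : ℕ :=
  Nat.card {σ : Equiv.Perm (Fin n) //
    PattAvoids (σ : Fin n → Fin n) (![0, 1, 3, 2] : Fin 4 → Fin 4) ∧
    PattAvoids (σ : Fin n → Fin n) (![1, 2, 0, 3] : Fin 4 → Fin 4)}

namespace AvCount

open Finset

/-- Append a new last entry of relative value `v`. -/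
noncomputable def ins {m : ℕ} (σ : Equiv.Perm (Fin m)) (v : Fin (m + 1)) :
    Equiv.Perm (Fin (m + 1)) :=
  Equiv.ofBijective
    (Fin.lastCases (motive := fun _ => Fin (m + 1)) v (fun j => v.succAbove (σ j)))
    (by
      apply Function.Injective.bijective_of_finite
      intro a b
      refine Fin.lastCases ?_ (fun a => ?_) a <;> refine Fin.lastCases ?_ (fun b => ?_) b
      · simp
      · simp
      · simp
      · simp)

theorem ins_last {m : ℕ} (σ : Equiv.Perm (Fin m)) (v : Fin (m + 1)) :
    ins σ v (Fin.last m) = v := by simp [ins]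

theorem ins_castSucc {m : ℕ} (σ : Equiv.Perm (Fin m)) (v : Fin (m + 1)) (j : Fin m) :
    ins σ v j.castSucc = v.succAbove (σ j) := by simp [ins]

theorem ins_castSucc_val {m : ℕ} (σ : Equiv.Perm (Fin m)) (v : Fin (m + 1)) (j : Fin m) :
    (ins σ v j.castSucc : ℕ) = if (σ j : ℕ) < v then (σ j : ℕ) else σ j + 1 := by
  rw [ins_castSucc, Fin.succAbove]
  simp only [Fin.lt_def, Fin.val_castSucc]
  split_ifs <;> simp

theorem ins_bij (m : ℕ) :
    Function.Bijective (fun p : Equiv.Perm (Fin m) × Fin (m + 1) => ins p.1 p.2) := by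
  rw [Fintype.bijective_iff_injective_and_card]
  constructor
  · rintro ⟨σ, v⟩ ⟨τ, w⟩ h
    simp only at h
    have hv : v = w := by rw [← ins_last σ v, h, ins_last]
    subst hv
    have : σ = τ := by
      ext j
      have := congrArg (fun e => e j.castSucc) h
      simp only [ins_castSucc] at this
      rw [Fin.succAbove_right_injective this]
    rw [this]
  · simp [Fintype.card_perm, Nat.factorial_succ, mul_comm]

theorem sum_ins {m : ℕ} (f : Equiv.Perm (Fin (m + 1)) → ℕ) :
    ∑ τ, f τ = ∑ σ : Equiv.Perm (Fin m), ∑ v, f (ins σ v) := by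
  rw [← Fintype.sum_prod_type']
  exact ((ins_bij m).sum_comp f).symm

/-- An occurrence of 1243 or 2314. -/
def Bad {m : ℕ} (σ : Equiv.Perm (Fin m)) : Prop :=
  ∃ s r q p : Fin m, p < q ∧ q < r ∧ r < s ∧
    (((σ p : ℕ) < σ q ∧ (σ q : ℕ) < σ s ∧ (σ s : ℕ) < σ r) ∨
     ((σ r : ℕ) < σ p ∧ (σ p : ℕ) < σ q ∧ (σ q : ℕ) < σ s))

/-- Inserting a last entry at `w` creates an occurrence. -/
def Dead {m : ℕ} (σ : Equiv.Perm (Fin m)) (w : ℕ) : Prop :=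
  ∃ r q p : Fin m, p < q ∧ q < r ∧
    (((σ p : ℕ) < σ q ∧ (σ q : ℕ) < w ∧ w ≤ (σ r : ℕ)) ∨
     ((σ r : ℕ) < σ p ∧ (σ p : ℕ) < σ q ∧ (σ q : ℕ) < w))

/-- There is an ascending pair with values between gaps `y` and `w`. -/
def Kil {m : ℕ} (σ : Equiv.Perm (Fin m)) (y w : ℕ) : Prop :=
  ∃ q p : Fin m, p < q ∧ y ≤ (σ p : ℕ) ∧ (σ p : ℕ) < σ q ∧ (σ q : ℕ) < w

theorem pattAvoids_iff {m : ℕ} (σ : Equiv.Perm (Fin m)) :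
    (PattAvoids (σ : Fin m → Fin m) (![0, 1, 3, 2] : Fin 4 → Fin 4) ∧
    PattAvoids (σ : Fin m → Fin m) (![1, 2, 0, 3] : Fin 4 → Fin 4)) ↔ ¬ Bad σ := by
  unfold PattAvoids
  rw [← not_or, not_iff_not]
  constructor
  · rintro (⟨f, hf, h⟩ | ⟨f, hf, h⟩)
    · have h01 := (h 0 1).1 (by decide)
      have h13 := (h 1 3).1 (by decide)
      have h32 := (h 3 2).1 (by decide)
      exact ⟨f 3, f 2, f 1, f 0, hf (by decide), hf (by decide), hf (by decide),
        Or.inl ⟨h01, h13, h32⟩⟩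
    · have h01 := (h 2 0).1 (by decide)
      have h13 := (h 0 1).1 (by decide)
      have h32 := (h 1 3).1 (by decide)
      exact ⟨f 3, f 2, f 1, f 0, hf (by decide), hf (by decide), hf (by decide),
        Or.inr ⟨h01, h13, h32⟩⟩
  · rintro ⟨s, r, q, p, h1, h2, h3, h⟩
    have hm : StrictMono ![p, q, r, s] := by
      rw [Fin.strictMono_iff_lt_succ]
      intro i
      fin_cases i <;> simp [h1, h2, h3]
    rcases h with h | h
    · refine Or.inl ⟨![p, q, r, s], hm, ?_⟩
      intro i j
      fin_cases i <;> fin_cases j <;> simp <;> omega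
    · refine Or.inr ⟨![p, q, r, s], hm, ?_⟩
      intro i j
      fin_cases i <;> fin_cases j <;> simp <;> omega

theorem not_last_lt {m : ℕ} (j : Fin (m + 1)) : ¬ (Fin.last m < j) :=
  not_lt.mpr (Fin.le_last j)

/-- The old gap containing the new gap `w` after inserting at `v`. -/
def old (v w : ℕ) : ℕ := if w ≤ v then w else w - 1

theorem bad_ins {m : ℕ} (σ : Equiv.Perm (Fin m)) (v : Fin (m + 1)) :
    Bad (ins σ v) ↔ Bad σ ∨ Dead σ v := by
  unfold Bad Dead
  rw [Fin.exists_fin_succ']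
  simp only [Fin.exists_fin_succ', not_last_lt, Fin.castSucc_lt_castSucc_iff, false_and, and_false,
    or_false, exists_false, ins_last, ins_castSucc_val, Fin.castSucc_lt_last, true_and]
  refine or_congr ?_ ?_
  · refine exists_congr fun s => exists_congr fun r => exists_congr fun q => exists_congr fun p =>
      and_congr_right fun _ => and_congr_right fun _ => and_congr_right fun _ => ?_
    split_ifs <;> omega
  · refine exists_congr fun r => exists_congr fun q => exists_congr fun p =>
      and_congr_right fun _ => and_congr_right fun _ => ?_
    split_ifs <;> omega

theorem dead_ins {m : ℕ} (σ : Equiv.Perm (Fin m)) (v : Fin (m + 1)) (w : ℕ) :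
    Dead (ins σ v) w ↔ Dead σ (old v w) ∨
      (((v : ℕ) < w ∧ Kil σ v (old v w)) ∨ (w ≤ v ∧ Kil σ 0 (old v w))) := by
  unfold Dead Kil old
  rw [Fin.exists_fin_succ']
  simp only [Fin.exists_fin_succ', not_last_lt, Fin.castSucc_lt_castSucc_iff, false_and, and_false,
    or_false, exists_false, ins_last, ins_castSucc_val, Fin.castSucc_lt_last, true_and]
  refine or_congr ?_ ?_
  · refine exists_congr fun r => exists_congr fun q => exists_congr fun p =>
      and_congr_right fun _ => and_congr_right fun _ => ?_
    split_ifs <;> omega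
  · simp only [← exists_and_left, ← exists_or]
    refine exists_congr fun q => exists_congr fun p => ?_
    by_cases hpq : p < q
    · simp only [hpq, true_and]
      split_ifs <;> omega
    · simp [hpq]

theorem kil_ins {m : ℕ} (σ : Equiv.Perm (Fin m)) (v : Fin (m + 1)) (y w : ℕ) :
    Kil (ins σ v) y w ↔ Kil σ (old v y) (old v w) ∨ (y < v ∧ (v : ℕ) < w) := by
  unfold Kil old
  rw [Fin.exists_fin_succ']
  simp only [Fin.exists_fin_succ', not_last_lt, Fin.castSucc_lt_castSucc_iff, false_and, and_false,
    or_false, exists_false, ins_last, ins_castSucc_val, Fin.castSucc_lt_last, true_and]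
  refine or_congr ?_ ?_
  · refine exists_congr fun q => exists_congr fun p => and_congr_right fun _ => ?_
    split_ifs <;> omega
  · constructor
    · rintro ⟨p, h⟩
      split_ifs at h <;> omega
    · rintro ⟨h1, h2⟩
      refine ⟨σ.symm ⟨y, by omega⟩, ?_⟩
      simp [h1, h2]

open Classical in
/-- Number of avoiding extensions of `σ` by `r` further entries. -/
noncomputable def ext : (r : ℕ) → {m : ℕ} → Equiv.Perm (Fin m) → ℕ
  | 0, _, σ => if Bad σ then 0 else 1
  | r + 1, _, σ => ∑ v, ext r (ins σ v)

theorem ext_bad (r : ℕ) : ∀ {m : ℕ} (σ : Equiv.Perm (Fin m)), Bad σ → ext r σ = 0 := by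
  induction r with
  | zero => intro m σ h; simp [ext, h]
  | succ r ih =>
    intro m σ h
    simp only [ext]
    exact Finset.sum_eq_zero fun v _ => ih _ ((bad_ins σ v).2 (Or.inl h))

theorem sum_ext (r : ℕ) : ∀ (m n : ℕ), m + r = n →
    ∑ σ : Equiv.Perm (Fin m), ext r σ = ∑ σ : Equiv.Perm (Fin n), ext 0 σ := by
  induction r with
  | zero => intro m n h; subst h; rfl
  | succ r ih =>
    intro m n h
    rw [← ih (m + 1) n (by omega), sum_ins]
    rfl

theorem avE_eq (n : ℕ) : avE n = ext n (1 : Equiv.Perm (Fin 0)) := by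
  classical
  have h := sum_ext n 0 n (by omega)
  rw [Fintype.sum_unique] at h
  have hd : (default : Equiv.Perm (Fin 0)) = 1 := Subsingleton.elim _ _
  rw [← hd, h]
  unfold avE
  simp only [pattAvoids_iff]
  rw [Nat.card_eq_fintype_card, Fintype.card_subtype, Finset.card_filter]
  refine Finset.sum_congr rfl fun σ _ => ?_
  simp only [ext]
  by_cases hb : Bad σ <;> simp [hb]

/-- The permutation `σ` has state `(a, b, L)`: it has `L` live gaps, enumerated by `g`. -/
structure Sim {m : ℕ} (σ : Equiv.Perm (Fin m)) (a b L : ℕ) (g : ℕ → ℕ) : Prop where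
  ha : 0 < a
  hab : a ≤ b
  hbL : b ≤ L
  mono : ∀ i j, i < j → j < L → g i < g j
  zero : g 0 = 0
  le : ∀ i, i < L → g i ≤ m
  live : ∀ i, i < L → ¬ Dead σ (g i)
  surj : ∀ w, w ≤ m → ¬ Dead σ w → ∃ i, i < L ∧ g i = w
  kil : ∀ i j, i < L → j < L → (Kil σ (g i) (g j) ↔ i < a ∧ b ≤ j)

theorem Sim.lt_iff {m : ℕ} {σ : Equiv.Perm (Fin m)} {a b L : ℕ} {g : ℕ → ℕ}
    (h : Sim σ a b L g) {i j : ℕ} (hi : i < L) (hj : j < L) : g i < g j ↔ i < j := by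
  constructor
  · intro hlt
    by_contra hc
    rcases Nat.lt_or_eq_of_le (not_lt.mp hc) with h1 | h1
    · have := h.mono _ _ h1 hi
      omega
    · subst h1; omega
  · intro hlt; exact h.mono _ _ hlt hj

/-- Number of extensions of a state. -/
def F : ℕ → ℕ → ℕ → ℕ → ℕ
  | 0, _, _, _ => 1
  | r + 1, a, b, L =>
    (∑ i ∈ range b, if i = 0 then F r (b + 1) (b + 1) (b + 1)
      else F r i (i + 1) ((if i < a then b else L) + 1)) +
    ∑ i ∈ range (L - b), F r b b (L - i)

/-- A uniform description of a step: the low block has `t` gaps (all of the old ones below `t`),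
the high block consists of the old gaps from `i` to `c`. -/
theorem Sim.step {m : ℕ} {σ : Equiv.Perm (Fin m)} {a b L : ℕ} {g : ℕ → ℕ}
    (h : Sim σ a b L g) {i : ℕ} (hi : i < L) (v : Fin (m + 1)) (hv : (v : ℕ) = g i)
    {a' b' L' t c : ℕ} (hc : c = if i < a then b else L) (ht : t = if i < b then i + 1 else b)
    (hL' : L' = t + c - i)
    (hab' : 0 < a' ∧ a' ≤ b' ∧ b' ≤ L')
    (hK : ∀ x y, x < L' → y < L' → ((x < a' ∧ b' ≤ y) ↔ (x < i ∧ x < t ∧ t ≤ y))) :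
    ∃ g', Sim (ins σ v) a' b' L' g' := by
  obtain ⟨h1, h2, h3, hm, h0, hle, hlive, hsurj, hkil⟩ := id h
  have hci : i < c := by rw [hc]; split_ifs <;> omega
  have hcL : c ≤ L := by rw [hc]; split_ifs <;> omega
  have ht0 : 0 < t := by rw [ht]; split_ifs <;> omega
  have hti : t ≤ i + 1 := by rw [ht]; split_ifs <;> omega
  have htb : t ≤ b := by rw [ht]; split_ifs <;> omega
  -- the value of `old` on the new gaps
  have old_low : ∀ x, x < t → old v (g x) = g x ∧ g x ≤ v ∧ (g x < v ↔ x < i) := by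
    intro x hx
    have h4 := h.lt_iff (i := x) (j := i) (by omega) hi
    have h5 := h.lt_iff (i := i) (j := x) hi (by omega)
    unfold old
    split_ifs <;> omega
  have old_high : ∀ x, i ≤ x → x < L → old v (g x + 1) = g x ∧ (v : ℕ) < g x + 1 := by
    intro x hx hxL
    have h5 := h.lt_iff (i := x) (j := i) hxL hi
    unfold old
    split_ifs <;> omega
  refine ⟨fun j => if j < t then g j else g (j - t + i) + 1, ?_⟩
  refine ⟨hab'.1, hab'.2.1, hab'.2.2, ?_, ?_, ?_, ?_, ?_, ?_⟩
  · intro x y hxy hy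
    try dsimp only
    by_cases hyt : y < t
    · rw [if_pos (by omega), if_pos hyt]
      exact hm _ _ hxy (by omega)
    · by_cases hxt : x < t
      · rw [if_pos hxt, if_neg hyt]
        have := old_low x hxt
        have := old_high (y - t + i) (by omega) (by omega)
        omega
      · rw [if_neg hxt, if_neg hyt]
        have := hm (x - t + i) (y - t + i) (by omega) (by omega)
        omega
  · simp [ht0, h0]
  · intro x hx
    try dsimp only
    split_ifs with hxt
    · have := hle x (by omega); omega
    · have := hle (x - t + i) (by omega); omega
  · intro x hx
    try dsimp only
    rw [dead_ins]
    split_ifs with hxt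
    · have h4 := old_low x hxt
      rw [h4.1]
      have h5 := hlive x (by omega)
      have h6 := hkil 0 x (by omega) (by omega)
      rw [h0] at h6
      rintro (h7 | h7 | h7)
      · exact h5 h7
      · omega
      · have := h6.1 h7.2
        omega
    · have h4 := old_high (x - t + i) (by omega) (by omega)
      rw [h4.1]
      have h5 := hlive (x - t + i) (by omega)
      have h6 := hkil i (x - t + i) (by omega) (by omega)
      rw [hv] at h4 ⊢
      rintro (h7 | h7 | h7)
      · exact h5 h7
      · have := h6.1 h7.2
        rw [if_pos this.1] at hc
        omega
      · omega
  · intro w hw hd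
    rw [dead_ins] at hd
    push Not at hd
    obtain ⟨hd1, hd2, hd3⟩ := hd
    obtain ⟨x, hx, hgx⟩ := hsurj (old v w) (by unfold old; split_ifs <;> omega) hd1
    rw [← hgx] at hd2 hd3
    by_cases hwv : w ≤ v
    · have h4 : g x = w := by rw [hgx]; simp [old, hwv]
      have h5 := hd3 hwv
      have h6 := hkil 0 x (by omega) hx
      rw [h0] at h6
      have h7 := h.lt_iff hi hx
      have hxb : x < b := by
        by_contra hcon
        exact h5 (h6.2 ⟨h1, by omega⟩)
      have hxt : x < t := by rw [ht]; split_ifs <;> omega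
      exact ⟨x, by omega, by simp [hxt, h4]⟩
    · have h4 : g x + 1 = w := by rw [hgx]; simp [old, hwv]; omega
      have h5 := hd2 (by omega)
      rw [hv] at h5
      have h6 := hkil i x hi hx
      have h7 := h.lt_iff hx hi
      have hxc : x < c := by
        rw [hc]
        split_ifs with hia
        · by_contra hcon
          exact h5 (h6.2 ⟨hia, by omega⟩)
        · exact hx
      refine ⟨x - i + t, by omega, ?_⟩
      have e1 : ¬ (x - i + t < t) := by omega
      have e2 : x - i + t - t + i = x := by omega
      simp only [e1, if_false, e2, h4]
  · intro x y hx hy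
    rw [hK x y hx hy, kil_ins]
    try dsimp only
    by_cases hxt : x < t
    · have hx4 := old_low x hxt
      rw [if_pos hxt, hx4.1]
      by_cases hyt : y < t
      · have hy4 := old_low y hyt
        rw [if_pos hyt, hy4.1, hkil x y (by omega) (by omega)]
        omega
      · have hy4 := old_high (y - t + i) (by omega) (by omega)
        rw [if_neg hyt, hy4.1, hkil x _ (by omega) (by omega)]
        by_cases hia : i < a
        · rw [if_pos hia] at hc
          omega
        · rw [if_neg hia] at hc
          by_cases hib : i < b
          · rw [if_pos hib] at ht
            omega
          · rw [if_neg hib] at ht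
            omega
    · have hx4 := old_high (x - t + i) (by omega) (by omega)
      rw [if_neg hxt, hx4.1]
      by_cases hyt : y < t
      · have hy4 := old_low y hyt
        rw [if_pos hyt, hy4.1, hkil _ y (by omega) (by omega)]
        omega
      · have hy4 := old_high (y - t + i) (by omega) (by omega)
        rw [if_neg hyt, hy4.1, hkil _ _ (by omega) (by omega)]
        by_cases hia : i < a
        · rw [if_pos hia] at hc
          omega
        · omega

theorem ext_eq (r : ℕ) : ∀ {m : ℕ} (σ : Equiv.Perm (Fin m)) (a b L : ℕ) (g : ℕ → ℕ),
    ¬ Bad σ → Sim σ a b L g → ext r σ = F r a b L := by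
  induction r with
  | zero => intro m σ a b L g hb _; simp [ext, F, hb]
  | succ r ih =>
    intro m σ a b L g hb h
    obtain ⟨h1, h2, h3, hm, h0, hle, hlive, hsurj, hkil⟩ := id h
    have key : ext (r + 1) σ = ∑ i ∈ range L,
        if hi : i < L then ext r (ins σ ⟨g i, Nat.lt_succ_of_le (hle i hi)⟩) else 0 := by
      simp only [ext]
      symm
      refine Finset.sum_of_injOn
        (fun i => if hi : i < L then (⟨g i, Nat.lt_succ_of_le (hle i hi)⟩ : Fin (m + 1)) else 0)
        ?_ ?_ ?_ ?_
      · intro x hx y hy hxy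
        simp only [coe_range, Set.mem_Iio] at hx hy
        simp only [hx, hy, dif_pos, Fin.mk.injEq] at hxy
        have := h.lt_iff hx hy
        have := h.lt_iff hy hx
        omega
      · intro x _; simp
      · intro w _ hw
        apply ext_bad
        rw [bad_ins]
        right
        by_contra hd
        obtain ⟨i, hi, hgi⟩ := hsurj w (by omega) hd
        apply hw
        refine ⟨i, by simpa using hi, ?_⟩
        simp [hi, hgi]
      · intro x hx
        simp only [Finset.mem_range] at hx
        simp [hx]
    rw [key, F]
    have hsplit : L = b + (L - b) := by omega
    have hnb : ∀ i (hi : i < L), ¬ Bad (ins σ ⟨g i, Nat.lt_succ_of_le (hle i hi)⟩) := by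
      intro i hi
      rw [bad_ins]
      rintro (h4 | h4)
      · exact hb h4
      · exact hlive i hi h4
    have hr : range L = range (b + (L - b)) := congrArg range hsplit
    rw [hr, Finset.sum_range_add]
    refine congrArg₂ (· + ·) ?_ ?_
    · refine Finset.sum_congr rfl fun i hi => ?_
      rw [Finset.mem_range] at hi
      have hiL : i < L := by omega
      rw [dif_pos (by omega)]
      by_cases hi0 : i = 0
      · subst hi0
        rw [if_pos rfl]
        obtain ⟨g', hg'⟩ := h.step (i := 0) hiL ⟨g 0, Nat.lt_succ_of_le (hle 0 hiL)⟩ rfl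
          (a' := b + 1) (b' := b + 1) (L' := b + 1) (t := 1) (c := b)
          (by rw [if_pos h1]) (by rw [if_pos hi]) (by omega) (by omega)
          (by intro x y hx hy; omega)
        exact ih _ _ _ _ _ (hnb 0 hiL) hg'
      · rw [if_neg hi0]
        obtain ⟨g', hg'⟩ := h.step (i := i) hiL ⟨g i, Nat.lt_succ_of_le (hle i hiL)⟩ rfl
          (a' := i) (b' := i + 1) (L' := (if i < a then b else L) + 1) (t := i + 1)
          rfl (by rw [if_pos hi]) (by omega) (by split_ifs <;> omega)
          (by intro x y hx hy; omega)
        exact ih _ _ _ _ _ (hnb i hiL) hg'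
    · refine Finset.sum_congr rfl fun k hk => ?_
      rw [Finset.mem_range] at hk
      have hiL : b + k < L := by omega
      rw [dif_pos (by omega)]
      obtain ⟨g', hg'⟩ := h.step (i := b + k) hiL ⟨g (b + k), Nat.lt_succ_of_le (hle _ hiL)⟩ rfl
        (a' := b) (b' := b) (L' := L - k) (t := b) (c := L)
        (by rw [if_neg (by omega)]) (by rw [if_neg (by omega)]) (by omega) (by omega)
        (by intro x y hx hy; omega)
      exact ih _ _ _ _ _ (hnb _ hiL) hg'

theorem avE_eq_F (n : ℕ) : avE n = F n 1 1 1 := by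
  rw [avE_eq]
  refine ext_eq n _ 1 1 1 (fun i => i) ?_ ?_
  · rintro ⟨s, _⟩; exact s.elim0
  · refine ⟨by omega, by omega, by omega, by intros; omega, rfl, by intros; omega, ?_, ?_, ?_⟩
    · rintro i _ ⟨s, _⟩; exact s.elim0
    · intro w hw _; exact ⟨w, by omega, rfl⟩
    · intro i j hi hj
      constructor
      · rintro ⟨s, _⟩; exact s.elim0
      · omega

/-- Sum of `f` over `0, …, n - 1`, by structural recursion. -/
def sumTo (f : ℕ → ℕ) : ℕ → ℕ
  | 0 => 0
  | n + 1 => sumTo f n + f n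

theorem sumTo_eq (f : ℕ → ℕ) (n : ℕ) : sumTo f n = ∑ i ∈ range n, f i := by
  induction n with
  | zero => rfl
  | succ n ih => rw [sumTo, ih, Finset.sum_range_succ]

/-- Evaluate the argument `n` before passing it on, so that the kernel sees numerals (and can
reuse results it has already computed). -/
def force (n : ℕ) (k : ℕ → ℕ) : ℕ :=
  match n with
  | 0 => k 0
  | m + 1 => k (m + 1)

theorem force_eq (n : ℕ) (k : ℕ → ℕ) : force n k = k n := by
  cases n <;> rfl

/-- Version of `F` for kernel evaluation. -/
def G : ℕ → ℕ → ℕ → ℕ → ℕ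
  | 0, _, _, _ => 1
  | r + 1, a, b, L =>
    sumTo (fun i => if i = 0 then force (b + 1) fun c => G r c c c
      else force i fun i => force (i + 1) fun j =>
        force ((if i < a then b else L) + 1) fun c => G r i j c) b +
    sumTo (fun i => force (L - i) fun c => G r b b c) (L - b)

theorem F_eq_G (r : ℕ) : ∀ a b L, F r a b L = G r a b L := by
  induction r with
  | zero => intros; rfl
  | succ r ih => intro a b L; simp only [F, G, sumTo_eq, force_eq, ih]

end AvCount

theorem av_1243_2314_initial_terms :
    avE 1 = 1 ∧ avE 2 = 2 ∧ avE 3 = 6 ∧ avE 4 = 22 ∧ avE 5 = 88 ∧ avE 6 = 367 ∧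
    avE 7 = 1571 ∧ avE 8 = 6861 ∧ avE 9 = 30468 ∧ avE 10 = 137229 ∧
    avE 11 = 625573 ∧ avE 12 = 2881230 := by
  simp only [AvCount.avE_eq_F, AvCount.F_eq_G]
  decide +kernel
end

section
/- For every n ≥ 1, the number of permutations of length n avoiding 1234 and 2341 is at most 4^n, and the limit of the n-th root of this count as n → ∞ equals 4. -/
section Helpers

open PowerSeries

def NNS (f : PowerSeries ℤ) : Prop := ∀ n, 0 ≤ coeff n f

lemma NNS.add {f g : PowerSeries ℤ} (hf : NNS f) (hg : NNS g) : NNS (f + g) := by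
  intro n; rw [map_add]; exact add_nonneg (hf n) (hg n)

lemma NNS.mul {f g : PowerSeries ℤ} (hf : NNS f) (hg : NNS g) : NNS (f * g) := by
  intro n; rw [coeff_mul]; exact Finset.sum_nonneg fun p _ => mul_nonneg (hf _) (hg _)

lemma NNS.one : NNS 1 := by
  intro n; rw [coeff_one]; split_ifs <;> simp

lemma NNS.zero : NNS 0 := by
  intro n; simp

lemma NNS.X : NNS (X : PowerSeries ℤ) := by
  intro n; rw [coeff_X]; split_ifs <;> simp

lemma NNS.pow {f : PowerSeries ℤ} (hf : NNS f) (k : ℕ) : NNS (f ^ k) := by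
  induction k with
  | zero => simpa using NNS.one
  | succ k ih => rw [pow_succ]; exact ih.mul hf

lemma NNS.natCast (k : ℕ) : NNS (k : PowerSeries ℤ) := by
  induction k with
  | zero => simpa using NNS.zero
  | succ k ih => push_cast; exact ih.add NNS.one

lemma NNS.sum {ι : Type*} (s : Finset ι) {f : ι → PowerSeries ℤ} (hf : ∀ i ∈ s, NNS (f i)) :
    NNS (∑ i ∈ s, f i) := by
  intro n; rw [map_sum]; exact Finset.sum_nonneg fun i hi => hf i hi n

lemma NNS.le {f g : PowerSeries ℤ} (h : NNS (g - f)) (n : ℕ) : coeff n f ≤ coeff n g := by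
  have := h n; rw [map_sub] at this; linarith

/-- Catalan series. -/
noncomputable def Cs : PowerSeries ℤ := PowerSeries.mk fun n => (catalan n : ℤ)

lemma Cs_eq : Cs = 1 + X * Cs ^ 2 := by
  have h := congrArg (PowerSeries.map (Nat.castRingHom ℤ)) catalanSeries_sq_mul_X_add_one
  have h2 : PowerSeries.map (Nat.castRingHom ℤ) catalanSeries = Cs := by
    ext n; simp [Cs, catalanSeries]
  simp only [map_add, map_mul, map_pow, h2, PowerSeries.map_X, map_one] at h
  linear_combination -h

lemma NNS.Cs : NNS Cs := by
  intro n; simp [_root_.Cs]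

/-- Geometric series. -/
noncomputable def Ws : PowerSeries ℤ := PowerSeries.mk fun _ => 1

lemma Ws_eq : Ws = 1 + X * Ws := by
  ext n
  cases n with
  | zero => simp [Ws]
  | succ n => simp [Ws, coeff_succ_X_mul, coeff_one]

lemma NNS.Ws : NNS Ws := by
  intro n; simp [_root_.Ws]

noncomputable def Gs : PowerSeries ℤ := PowerSeries.invOfUnit (1 - X * Cs ^ 2) 1

lemma Gs_eq : Gs = 1 + X * Cs ^ 2 * Gs := by
  have h : (1 - X * Cs ^ 2) * Gs = 1 := by
    apply PowerSeries.mul_invOfUnit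
    simp
  linear_combination h

lemma NNS.Gs : NNS Gs := by
  intro n
  induction n using Nat.strong_induction_on with
  | _ n ih =>
    rw [Gs_eq]
    have h1 := NNS.one n
    cases n with
    | zero => simp
    | succ n =>
      rw [mul_assoc, map_add, coeff_succ_X_mul, coeff_mul]
      refine add_nonneg h1 (Finset.sum_nonneg fun p hp => mul_nonneg (NNS.Cs.pow 2 _) (ih _ ?_))
      have := Finset.HasAntidiagonal.mem_antidiagonal.1 hp
      omega

lemma Cpow_sum (x : ℕ) : Cs ^ (x + 1) = 1 + X * ∑ j ∈ Finset.range (x + 1), Cs ^ (j + 2) := by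
  induction x with
  | zero => simpa using Cs_eq
  | succ x ih =>
    rw [Finset.sum_range_succ, mul_add, ← add_assoc, ← ih]
    linear_combination Cs ^ (x + 1) * Cs_eq

lemma Wpow_sum (x : ℕ) : Ws ^ (x + 1) = 1 + X * ∑ j ∈ Finset.range (x + 1), Ws ^ (j + 1) := by
  induction x with
  | zero => simpa using Ws_eq
  | succ x ih =>
    rw [Finset.sum_range_succ, mul_add, ← add_assoc, ← ih]
    linear_combination Ws ^ (x + 1) * Ws_eq

/-- the E series; argument is `x - 1` -/
noncomputable def es (k : ℕ) : PowerSeries ℤ :=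
  Cs ^ (k + 2) * ((k : PowerSeries ℤ) + Cs * (X * Cs ^ 2)) * Gs

lemma es_sum (k : ℕ) : es k = X * ∑ j ∈ Finset.range (k + 2), es j
    + ∑ j ∈ Finset.range k, Cs ^ (j + 2) := by
  induction k with
  | zero =>
    simp only [es, Finset.sum_range_succ, Finset.sum_range_zero]
    push_cast
    have h := Cs_eq
    generalize Cs = C at *
    linear_combination (X * C ^ 3 * (C + 1) * Gs) * h
  | succ k ih =>
    rw [Finset.sum_range_succ _ (k+2), Finset.sum_range_succ _ k, mul_add]
    have : es (k+1) - es k = X * es (k+2) + Cs ^ (k+2) := by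
      simp only [es]
      push_cast
      have h := Cs_eq
      have hG := Gs_eq
      generalize Cs = C at *
      generalize Gs = G at *
      linear_combination (C^(k+2)) * hG + (C ^ (k + 2) * G * ((k : PowerSeries ℤ) + 1 + X * C ^ 3)) * h
    linear_combination this + ih

lemma NNS.es (k : ℕ) : NNS (es k) :=
  ((NNS.Cs.pow _).mul ((NNS.natCast k).add (NNS.Cs.mul (NNS.X.mul (NNS.Cs.pow _))))).mul NNS.Gs

lemma Cpow_sum' (k : ℕ) : Cs ^ k = 1 + X * ∑ j ∈ Finset.range k, Cs ^ (j + 2) := by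
  cases k with
  | zero => simp
  | succ k => exact Cpow_sum k

lemma Wpow_sum' (L : ℕ) : Ws ^ (L + 1) = Ws + X * ∑ j ∈ Finset.range L, Ws ^ (j + 2) := by
  rw [Wpow_sum, Finset.sum_range_succ']
  linear_combination -Ws_eq

lemma H_bound (k : ℕ) : NNS (Ws * ∑ j ∈ Finset.range k, Cs ^ (j + 2)
    - X * ∑ i ∈ Finset.range k, Cs ^ (i + 3) * Ws ^ (k - i + 1)) := by
  induction k with
  | zero => simpa using NNS.zero
  | succ k ih =>
    have e : ∑ i ∈ Finset.range (k + 1), Cs ^ (i + 3) * Ws ^ (k + 1 - i + 1)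
        = Ws * ∑ i ∈ Finset.range k, Cs ^ (i + 3) * Ws ^ (k - i + 1) + Cs ^ (k + 3) * Ws ^ 2 := by
      rw [Finset.sum_range_succ, Finset.mul_sum]
      congr 1
      · refine Finset.sum_congr rfl fun i hi => ?_
        have := Finset.mem_range.1 hi
        rw [show k + 1 - i + 1 = (k - i + 1) + 1 by omega]
        ring
      · simp
    rw [e, Finset.sum_range_succ]
    have h1 := Cpow_sum' (k + 2)
    rw [Finset.sum_range_succ, Finset.sum_range_succ] at h1
    have hW := Ws_eq
    convert (NNS.Ws.mul ih).add (NNS.Ws.mul NNS.Ws) using 1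
    generalize ∑ i ∈ Finset.range k, Cs ^ (i + 3) * Ws ^ (k - i + 1) = H at *
    generalize ∑ j ∈ Finset.range k, Cs ^ (j + 2) = S at *
    generalize Cs = C at *
    generalize Ws = W at *
    linear_combination W ^ 2 * h1 + (-W * C ^ (k + 2) - W * S) * hW

/-- Potential of a phase-0 state with `k + 1` leading minima, first block of length `L`, and
later blocks `a`. -/
noncomputable def Vs (k L : ℕ) (a : List ℕ) : PowerSeries ℤ :=
  Cs ^ (k + 2) * (1 + (a.map fun l => Ws ^ (l + 1)).sum) + Cs ^ (L + 2) + Cs ^ (k + 3) * Ws ^ L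
    + (X * Cs ^ 2 + Ws) * es k

lemma NNS.listsum {f : ℕ → PowerSeries ℤ} (hf : ∀ i, NNS (f i)) (a : List ℕ) :
    NNS (a.map f).sum := by
  induction a with
  | nil => simpa using NNS.zero
  | cons l a ih => simpa using (hf l).add ih

lemma arch_slack (a : List ℕ) : NNS ((a.map fun l => Ws ^ (l + 1)).sum -
    X * (a.map fun l => ∑ j ∈ Finset.range l, Ws ^ (j + 2)).sum) := by
  induction a with
  | nil => simpa using NNS.zero
  | cons l a ih =>
    convert ih.add NNS.Ws using 1
    simp only [List.map_cons, List.sum_cons]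
    linear_combination Wpow_sum' l

lemma NNS.Vs (k L : ℕ) (a : List ℕ) : NNS (Vs k L a) := by
  have h1 := NNS.listsum (f := fun l => _root_.Ws ^ (l + 1)) (fun i => NNS.Ws.pow _) a
  exact ((((NNS.Cs.pow _).mul (NNS.one.add h1)).add (NNS.Cs.pow _)).add
    ((NNS.Cs.pow _).mul (NNS.Ws.pow _))).add
    (((NNS.X.mul (NNS.Cs.pow _)).add NNS.Ws).mul (NNS.es k))

lemma coeff_zero_Cs_pow (k : ℕ) : coeff 0 (Cs ^ k) = 1 := by
  rw [Cpow_sum' k]; simp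

lemma coeff_zero_Ws_pow (k : ℕ) : coeff 0 (Ws ^ k) = 1 := by
  simp [Ws]

lemma coeff_zero_Vs (k L : ℕ) (a : List ℕ) : 1 ≤ coeff 0 (Vs k L a) := by
  have h1 := NNS.listsum (f := fun l => _root_.Ws ^ (l + 1)) (fun i => NNS.Ws.pow _) a
  have h2 := (((NNS.Cs.pow (k+2)).mul h1).add ((NNS.Cs.pow (k+3)).mul (NNS.Ws.pow L))).add
    (((NNS.X.mul (NNS.Cs.pow 2)).add NNS.Ws).mul (NNS.es k)) 0
  have h3 : coeff 0 (Cs ^ (L+2)) = 1 := coeff_zero_Cs_pow _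
  have h4 := NNS.Cs.pow (k+2) 0
  unfold Vs
  rw [mul_add]
  simp only [map_add, mul_one] at *
  linarith

lemma Vs_step (k L : ℕ) (a : List ℕ) : NNS (Vs k L a - X * (
    ∑ j ∈ Finset.range L, Cs ^ (j + 2) +
    (a.map fun l => ∑ j ∈ Finset.range l, Ws ^ (j + 2)).sum +
    Vs (k + 1) L a + Vs k (L + 1) a +
    ∑ i ∈ Finset.range k, Vs i (k - i + 1) (L :: a))) := by
  have hs : ∑ i ∈ Finset.range k, Vs i (k - i + 1) (L :: a) =
      (1 + (a.map fun l => Ws ^ (l + 1)).sum + Ws ^ (L + 1)) * ∑ i ∈ Finset.range k, Cs ^ (i + 2)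
      + Cs ^ 2 * ∑ i ∈ Finset.range k, Cs ^ (i + 2)
      + ∑ i ∈ Finset.range k, Cs ^ (i + 3) * Ws ^ (k - i + 1)
      + (X * Cs ^ 2 + Ws) * ∑ i ∈ Finset.range k, es i := by
    have hr : Cs ^ 2 * ∑ i ∈ Finset.range k, Cs ^ (i + 2)
        = ∑ i ∈ Finset.range k, Cs ^ (k - i + 1 + 2) := by
      rw [← Finset.sum_range_reflect, Finset.mul_sum]
      refine Finset.sum_congr rfl fun i hi => ?_
      have := Finset.mem_range.1 hi
      rw [← pow_add]
      congr 1
      omega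
    rw [hr]
    simp only [Vs, Finset.mul_sum, ← Finset.sum_add_distrib, List.map_cons, List.sum_cons]
    refine Finset.sum_congr rfl fun i hi => ?_
    ring
  rw [hs]
  have hH := H_bound k
  have hA := arch_slack a
  have hSn := NNS.listsum (f := fun l => _root_.Ws ^ (l + 1)) (fun i => NNS.Ws.pow _) a
  have h1 := Cpow_sum' (k + 2)
  rw [Finset.sum_range_succ, Finset.sum_range_succ] at h1
  have h2 := Cpow_sum' (L + 2)
  rw [Finset.sum_range_succ, Finset.sum_range_succ] at h2
  have h3 := Cpow_sum' k
  have h4 := es_sum k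
  rw [Finset.sum_range_succ, Finset.sum_range_succ] at h4
  have hW := Ws_eq
  have hC := Cs_eq
  have hwn := NNS.Ws.pow (L + 1)
  convert ((hH.add hA).add (NNS.one.add NNS.one)).add hwn using 1
  unfold Vs
  generalize ∑ i ∈ Finset.range k, Cs ^ (i + 3) * Ws ^ (k - i + 1) = H at *
  generalize ∑ j ∈ Finset.range k, Cs ^ (j + 2) = S at *
  generalize ∑ j ∈ Finset.range L, Cs ^ (j + 2) = S2 at *
  generalize ∑ j ∈ Finset.range k, es j = S3 at *
  generalize (a.map fun l => Ws ^ (l + 1)).sum = S4 at *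
  generalize (a.map fun l => ∑ j ∈ Finset.range l, Ws ^ (j + 2)).sum = S5 at *
  generalize es k = e0 at *
  generalize es (k + 1) = e1 at *
  generalize Cs = C at *
  generalize Ws = W at *
  have h5 : C ^ 3 - X * C ^ 4 - X * C ^ 3 * W = W := by
    linear_combination (C ^ 2 + W * (C + 1)) * hC - C ^ 2 * hW
  linear_combination (1 + S4) * h1 + h2 + (X * C ^ 2 + W) * h4 + W ^ (L + 1) * h3
    + C ^ k * W ^ L * h5

noncomputable def Qs : PowerSeries ℤ := PowerSeries.mk fun n => 4 ^ n

lemma Qs_eq : Qs = 1 + 4 * X * Qs := by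
  ext n
  have : (4 * X * Qs : PowerSeries ℤ) = X * ((4:ℤ) • Qs) := by
    rw [zsmul_eq_mul]; push_cast; ring
  rw [this]
  cases n with
  | zero => simp [Qs]
  | succ n =>
    rw [map_add, coeff_succ_X_mul, map_zsmul]
    simp [Qs, coeff_one, pow_succ, mul_comm]

lemma final_bound (m : ℕ) : coeff m (Vs 0 0 []) ≤ 4 ^ (m + 1) := by
  have hC := Cs_eq
  have hW := Ws_eq
  have hG := Gs_eq
  have hQ := Qs_eq
  have q1 : (Cs * Gs) ^ 2 * (1 - 4 * X) = 1 := by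
    generalize Cs = C at *
    generalize Gs = G at *
    have : G * (1 - X * C ^ 2) = 1 := by linear_combination hG
    linear_combination (G * (1 - X * C ^ 2) + 1) * this + G ^ 2 * (C + 1 + X * C ^ 2) * hC
  have q2 : Qs = (Cs * Gs) ^ 2 := by
    linear_combination (-Qs) * q1 + (Cs * Gs) ^ 2 * hQ
  have wb : NNS (1 + X * Cs - Ws) := by
    convert NNS.Ws.mul (NNS.X.mul (NNS.X.mul (NNS.X.mul (NNS.Cs.mul (NNS.Cs.pow 2))))) using 1
    generalize Cs = C at *
    generalize Ws = W at *
    linear_combination (-(1 + X * C)) * hW + (W * X * (1 + X * C)) * hC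
  have cn : NNS (X * Cs ^ 2) := NNS.X.mul (NNS.Cs.pow 2)
  have key : NNS (Qs - 1 - X * Vs 0 0 []) := by
    have t1 := wb.mul ((((cn.mul cn).mul NNS.Cs).mul NNS.Gs))
    have g2 := NNS.Gs.mul NNS.Gs
    have cc := cn.mul cn
    have t2 := (((((((cn.mul g2).add (cc.mul g2)).add (((cc.add cc).add cc).mul NNS.Gs))).add
      ((cc.mul cc).mul g2)).add (((cc.mul cc).mul cn).mul g2)))
    convert t1.add t2 using 1
    rw [q2]
    simp only [Vs, es]
    simp only [List.map_nil, List.sum_nil, Nat.cast_zero]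
    generalize Gs = G at *
    generalize Cs = C at *
    generalize Ws = W at *
    have e1 : ∀ c : PowerSeries ℤ, G = 1 + c * G → (1 + c) ^ 2 * G ^ 2 - 1 - 3 * c - c ^ 2
        - (c ^ 2 + 3 * c ^ 3 + c ^ 4) * G - (c * (G * G) + c * c * (G * G)
        + (c * c + c * c + c * c) * G + c * c * (c * c) * (G * G)
        + c * c * (c * c) * c * (G * G)) = 0 := by
      intro c hc
      linear_combination ((1 + c) ^ 2 * (1 + c ^ 2) * G + (1 + 3 * c + c ^ 2)) * hc
    have e2 := e1 _ hG
    have e3 : X * C * C = X * C ^ 2 := by ring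
    generalize hc : X * C ^ 2 = c at *
    have e4 : X * (C ^ (0 + 2) * (1 + 0) + C ^ (0 + 2) + C ^ (0 + 3) * W ^ 0 +
        (c + W) * (C ^ (0 + 2) * (0 + C * c) * G)) = 2 * c + c * C + (c + W) * c * c * C * G := by
      rw [← hc]; ring
    rw [e4]
    subst hC
    linear_combination e2 - c * c * G * e3
  have := key (m + 1)
  rw [map_sub, map_sub, coeff_succ_X_mul] at this
  simp [Qs, coeff_one] at this
  linarith

/-- Append a last entry of relative value `v`. -/
def extP {n : ℕ} (τ : Equiv.Perm (Fin n)) (v : Fin (n + 1)) : Equiv.Perm (Fin (n + 1)) :=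
  (finSuccEquivLast.trans (Equiv.optionCongr τ)).trans (finSuccEquiv' v).symm

lemma extP_last {n : ℕ} (τ : Equiv.Perm (Fin n)) (v : Fin (n + 1)) :
    extP τ v (Fin.last n) = v := by
  simp [extP]

lemma extP_castSucc {n : ℕ} (τ : Equiv.Perm (Fin n)) (v : Fin (n + 1)) (i : Fin n) :
    extP τ v i.castSucc = v.succAbove (τ i) := by
  simp [extP]

lemma extP_bij (n : ℕ) :
    Function.Bijective (fun p : Equiv.Perm (Fin n) × Fin (n + 1) => extP p.1 p.2) := by
  rw [Fintype.bijective_iff_injective_and_card]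
  constructor
  · rintro ⟨τ, v⟩ ⟨τ', v'⟩ h
    simp only at h
    have hv : v = v' := by rw [← extP_last τ v, h, extP_last]
    subst hv
    congr 1
    ext i
    have := extP_castSucc τ v i
    rw [h, extP_castSucc] at this
    rw [Fin.succAbove_right_injective this]
  · simp [Fintype.card_perm, Nat.factorial_succ, mul_comm]

def Good {n : ℕ} (τ : Equiv.Perm (Fin n)) : Prop :=
  PattAvoids (τ : Fin n → Fin n) (![0, 1, 2, 3] : Fin 4 → Fin 4) ∧
    PattAvoids (τ : Fin n → Fin n) (![1, 2, 3, 0] : Fin 4 → Fin 4)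

open Classical in
noncomputable def cnt : (m : ℕ) → {n : ℕ} → Equiv.Perm (Fin n) → ℕ
  | 0, _, τ => if Good τ then 1 else 0
  | m + 1, _, τ => ∑ v, cnt m (extP τ v)

lemma sum_cnt (m : ℕ) : ∀ n : ℕ, ∑ τ : Equiv.Perm (Fin n), cnt m τ = avF (n + m) := by
  classical
  induction m with
  | zero =>
    intro n
    simp only [cnt, avF, Good]
    rw [Nat.card_eq_fintype_card, Fintype.card_subtype, Finset.card_filter]
    refine Finset.sum_congr rfl fun τ _ => ?_
    congr
  | succ m ih =>
    intro n
    rw [show n + (m + 1) = n + 1 + m by omega, ← ih (n + 1)]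
    simp only [cnt]
    rw [← Fintype.sum_prod_type']
    exact (extP_bij n).sum_comp (fun σ => cnt m σ)

lemma avF_eq_cnt (m : ℕ) : avF m = cnt m (1 : Equiv.Perm (Fin 0)) := by
  have := sum_cnt m 0
  rw [zero_add] at this
  rw [← this]
  rw [Fintype.sum_subsingleton _ 1]

lemma contains_ext {n k : ℕ} (τ : Equiv.Perm (Fin n)) (v : Fin (n + 1)) (π : Fin k → Fin k)
    (h : PattContains (τ : Fin n → Fin n) π) :
    PattContains (extP τ v : Fin (n + 1) → Fin (n + 1)) π := by
  obtain ⟨f, hf, h⟩ := h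
  refine ⟨fun i => (f i).castSucc, fun i j hij => by simpa using hf hij, fun i j => ?_⟩
  rw [extP_castSucc, extP_castSucc, h i j, Fin.succAbove_lt_succAbove_iff]

lemma not_good_ext {n : ℕ} (τ : Equiv.Perm (Fin n)) (v : Fin (n + 1)) (h : ¬ Good τ) :
    ¬ Good (extP τ v) := by
  intro hg
  apply h
  exact ⟨fun hc => hg.1 (contains_ext τ v _ hc), fun hc => hg.2 (contains_ext τ v _ hc)⟩

lemma cnt_eq_zero (m : ℕ) : ∀ {n : ℕ} (τ : Equiv.Perm (Fin n)), ¬ Good τ → cnt m τ = 0 := by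
  induction m with
  | zero => intro n τ h; simp [cnt, h]
  | succ m ih =>
    intro n τ h
    simp only [cnt]
    exact Finset.sum_eq_zero fun v _ => ih _ (not_good_ext τ v h)

lemma not_good_1234 {n : ℕ} (τ : Equiv.Perm (Fin n)) (i j k l : Fin n) (h1 : i < j) (h2 : j < k)
    (h3 : k < l) (v1 : τ i < τ j) (v2 : τ j < τ k) (v3 : τ k < τ l) : ¬ Good τ := by
  intro hg
  refine hg.1 ⟨![i, j, k, l], ?_, ?_⟩
  · rw [Fin.strictMono_iff_lt_succ]
    intro a; fin_cases a <;> simpa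
  · intro a b
    fin_cases a <;> fin_cases b <;> simp <;> order

lemma not_good_2341 {n : ℕ} (τ : Equiv.Perm (Fin n)) (i j k l : Fin n) (h1 : i < j) (h2 : j < k)
    (h3 : k < l) (v1 : τ i < τ j) (v2 : τ j < τ k) (v3 : τ l < τ i) : ¬ Good τ := by
  intro hg
  refine hg.2 ⟨![i, j, k, l], ?_, ?_⟩
  · rw [Fin.strictMono_iff_lt_succ]
    intro a; fin_cases a <;> simpa
  · intro a b
    fin_cases a <;> fin_cases b <;> simp <;> order

lemma good_of_no123 {n : ℕ} (τ : Equiv.Perm (Fin n))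
    (h : ∀ i j k : Fin n, i < j → j < k → τ i < τ j → ¬ τ j < τ k) : Good τ := by
  constructor
  · rintro ⟨f, hf, hp⟩
    exact h (f 0) (f 1) (f 2) (hf (by decide)) (hf (by decide)) ((hp 0 1).1 (by decide))
      ((hp 1 2).1 (by decide))
  · rintro ⟨f, hf, hp⟩
    exact h (f 0) (f 1) (f 2) (hf (by decide)) (hf (by decide)) ((hp 0 1).1 (by decide))
      ((hp 1 2).1 (by decide))

/-- Extension at a natural-number site. -/
def extN {n : ℕ} (τ : Equiv.Perm (Fin n)) (v : ℕ) : Equiv.Perm (Fin (n + 1)) :=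
  extP τ (Fin.ofNat (n + 1) v)

lemma cnt_succ (m : ℕ) {n : ℕ} (τ : Equiv.Perm (Fin n)) :
    cnt (m + 1) τ = ∑ v ∈ Finset.range (n + 1), cnt m (extN τ v) := by
  rw [Finset.sum_range]
  simp only [cnt, extN]
  refine Finset.sum_congr rfl fun v _ => ?_
  congr 2
  ext
  simp [Nat.mod_eq_of_lt v.2]

lemma extN_last {n : ℕ} (τ : Equiv.Perm (Fin n)) (v : ℕ) (hv : v ≤ n) :
    (extN τ v (Fin.last n) : ℕ) = v := by
  rw [extN, extP_last]; simp; omega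

lemma extN_castSucc {n : ℕ} (τ : Equiv.Perm (Fin n)) (v : ℕ) (hv : v ≤ n) (i : Fin n) :
    (extN τ v i.castSucc : ℕ) = if (τ i : ℕ) < v then (τ i : ℕ) else (τ i : ℕ) + 1 := by
  rw [extN, extP_castSucc, Fin.succAbove]
  have : ((Fin.ofNat (n + 1) v : Fin (n + 1)) : ℕ) = v := by simp; omega
  simp only [Fin.lt_def, this, Fin.val_castSucc]
  split_ifs <;> simp

/-- Values `a < b` with `a` occurring before `b`. -/
def Asc {n : ℕ} (τ : Equiv.Perm (Fin n)) (a b : ℕ) : Prop :=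
  ∃ i j : Fin n, i < j ∧ (τ i : ℕ) = a ∧ (τ j : ℕ) = b ∧ a < b

/-- A 123-pattern with bottom value `a` and top value `c`. -/
def Tri {n : ℕ} (τ : Equiv.Perm (Fin n)) (a c : ℕ) : Prop :=
  ∃ i j k : Fin n, i < j ∧ j < k ∧ (τ i : ℕ) = a ∧ τ i < τ j ∧ τ j < τ k ∧ (τ k : ℕ) = c

def sh (v a : ℕ) : ℕ := if a < v then a else a + 1

lemma sh_lt {v a b : ℕ} (h : a < b) : sh v a < sh v b := by
  unfold sh; split_ifs <;> omega

lemma Asc.ext {n : ℕ} {τ : Equiv.Perm (Fin n)} {a b : ℕ} (h : Asc τ a b) (v : ℕ) (hv : v ≤ n) :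
    Asc (extN τ v) (sh v a) (sh v b) := by
  obtain ⟨i, j, hij, rfl, rfl, hab⟩ := h
  exact ⟨i.castSucc, j.castSucc, by simpa using hij, extN_castSucc τ v hv i,
    extN_castSucc τ v hv j, sh_lt hab⟩

lemma Tri.ext {n : ℕ} {τ : Equiv.Perm (Fin n)} {a b : ℕ} (h : Tri τ a b) (v : ℕ) (hv : v ≤ n) :
    Tri (extN τ v) (sh v a) (sh v b) := by
  obtain ⟨i, j, k, hij, hjk, rfl, h1, h2, rfl⟩ := h
  refine ⟨i.castSucc, j.castSucc, k.castSucc, by simpa using hij, by simpa using hjk,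
    extN_castSucc τ v hv i, ?_, ?_, extN_castSucc τ v hv k⟩
  · rw [Fin.lt_def, extN_castSucc τ v hv, extN_castSucc τ v hv]; exact sh_lt h1
  · rw [Fin.lt_def, extN_castSucc τ v hv, extN_castSucc τ v hv]; exact sh_lt h2

lemma Asc.new {n : ℕ} (τ : Equiv.Perm (Fin n)) {a v : ℕ} (hv : v ≤ n) (h : a < v) :
    Asc (extN τ v) a v := by
  refine ⟨(τ.symm ⟨a, by omega⟩).castSucc, Fin.last n, Fin.castSucc_lt_last _, ?_,
    extN_last τ v hv, h⟩
  rw [extN_castSucc τ v hv]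
  simp [h]

lemma Tri.new {n : ℕ} {τ : Equiv.Perm (Fin n)} {a b : ℕ} (h : Asc τ a b) {v : ℕ} (hv : v ≤ n)
    (hb : b < v) : Tri (extN τ v) a v := by
  obtain ⟨i, j, hij, rfl, rfl, hab⟩ := h
  refine ⟨i.castSucc, j.castSucc, Fin.last n, by simpa using hij, Fin.castSucc_lt_last _, ?_, ?_,
    ?_, extN_last τ v hv⟩
  · rw [extN_castSucc τ v hv, if_pos (by omega)]
  · rw [Fin.lt_def, extN_castSucc τ v hv, extN_castSucc τ v hv]; exact sh_lt hab
  · rw [Fin.lt_def, extN_castSucc τ v hv, extN_last τ v hv, if_pos hb]; exact hb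

lemma Tri.lt {n : ℕ} {τ : Equiv.Perm (Fin n)} {a b : ℕ} (h : Tri τ a b) : b < n := by
  obtain ⟨i, j, k, hij, hjk, rfl, h1, h2, rfl⟩ := h
  exact (τ k).2

lemma Tri.lt' {n : ℕ} {τ : Equiv.Perm (Fin n)} {a b : ℕ} (h : Tri τ a b) : a < b := by
  obtain ⟨i, j, k, hij, hjk, rfl, h1, h2, rfl⟩ := h
  exact h1.trans h2

lemma Asc.lt {n : ℕ} {τ : Equiv.Perm (Fin n)} {a b : ℕ} (h : Asc τ a b) : b < n := by
  obtain ⟨i, j, hij, rfl, rfl, hab⟩ := h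
  exact (τ j).2

lemma cnt_zero_above (m : ℕ) {n : ℕ} {τ : Equiv.Perm (Fin n)} {a c : ℕ} (h : Tri τ a c) {v : ℕ}
    (hv : v ≤ n) (hc : c < v) : cnt m (extN τ v) = 0 := by
  apply cnt_eq_zero
  obtain ⟨i, j, k, hij, hjk, rfl, h1, h2, rfl⟩ := h
  refine not_good_1234 _ i.castSucc j.castSucc k.castSucc (Fin.last n) (by simpa using hij)
    (by simpa using hjk) (Fin.castSucc_lt_last _) ?_ ?_ ?_
  · rw [Fin.lt_def, extN_castSucc τ v hv, extN_castSucc τ v hv]; exact sh_lt h1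
  · rw [Fin.lt_def, extN_castSucc τ v hv, extN_castSucc τ v hv]; exact sh_lt h2
  · rw [Fin.lt_def, extN_castSucc τ v hv, extN_last τ v hv, if_pos hc]; exact hc

lemma cnt_zero_below (m : ℕ) {n : ℕ} {τ : Equiv.Perm (Fin n)} {a c : ℕ} (h : Tri τ a c) {v : ℕ}
    (hv : v ≤ n) (hc : v ≤ a) : cnt m (extN τ v) = 0 := by
  apply cnt_eq_zero
  obtain ⟨i, j, k, hij, hjk, rfl, h1, h2, rfl⟩ := h
  refine not_good_2341 _ i.castSucc j.castSucc k.castSucc (Fin.last n) (by simpa using hij)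
    (by simpa using hjk) (Fin.castSucc_lt_last _) ?_ ?_ ?_
  · rw [Fin.lt_def, extN_castSucc τ v hv, extN_castSucc τ v hv]; exact sh_lt h1
  · rw [Fin.lt_def, extN_castSucc τ v hv, extN_castSucc τ v hv]; exact sh_lt h2
  · rw [Fin.lt_def, extN_castSucc τ v hv, extN_last τ v hv, if_neg (by omega)]; omega

lemma sum_window (F f : ℕ → ℤ) (N l k : ℕ) (hf : ∀ j, j < k → 0 ≤ f j)
    (h1 : ∀ v, v < N → v < l → F v = 0) (h2 : ∀ v, v < N → l + k ≤ v → F v = 0)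
    (h3 : ∀ j, l + j < N → j < k → F (l + j) ≤ f j) :
    ∑ v ∈ Finset.range N, F v ≤ ∑ j ∈ Finset.range k, f j := by
  have e : ∑ j ∈ Finset.range k, f j = ∑ v ∈ Finset.Ico l (l + k), f (v - l) := by
    rw [Finset.sum_Ico_eq_sum_range]
    simp
  rw [e]
  have e2 : ∑ v ∈ Finset.range N, F v
      = ∑ v ∈ (Finset.range N).filter (fun v => l ≤ v ∧ v < l + k), F v := by
    symm
    apply Finset.sum_filter_of_ne
    intro v hv hne
    rw [Finset.mem_range] at hv
    by_contra hc
    rcases lt_or_ge v l with h | h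
    · exact hne (h1 v hv h)
    · exact hne (h2 v hv (by omega))
  rw [e2]
  calc _ ≤ ∑ v ∈ (Finset.range N).filter (fun v => l ≤ v ∧ v < l + k), f (v - l) := by
        apply Finset.sum_le_sum
        intro v hv
        simp only [Finset.mem_filter, Finset.mem_range] at hv
        have := h3 (v - l) (by omega) (by omega)
        rwa [show l + (v - l) = v by omega] at this
    _ ≤ _ := by
        apply Finset.sum_le_sum_of_subset_of_nonneg
        · intro v hv
          simp only [Finset.mem_filter, Finset.mem_range] at hv
          simp only [Finset.mem_Ico]; omega
        · intro v hv _
          simp only [Finset.mem_Ico] at hv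
          exact hf _ (by omega)

lemma cnt_zero_le {n : ℕ} (τ : Equiv.Perm (Fin n)) : cnt 0 τ ≤ 1 := by
  simp only [cnt]; split_ifs <;> simp

lemma le_sh (v a : ℕ) : a ≤ sh v a := by unfold sh; split_ifs <;> omega

lemma sh_le (v a : ℕ) : sh v a ≤ a + 1 := by unfold sh; split_ifs <;> omega

lemma sh_of_lt {v a : ℕ} (h : a < v) : sh v a = a := by simp [sh, h]

lemma sh_of_ge {v a : ℕ} (h : v ≤ a) : sh v a = a + 1 := by simp [sh, h]

def Inv2 {n : ℕ} (τ : Equiv.Perm (Fin n)) (l y : ℕ) : Prop :=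
  (∃ a c, Tri τ a c ∧ l ≤ a) ∧ (∃ a c, Tri τ a c ∧ c ≤ l + 1 + y) ∧ (∃ a b, Asc τ a b ∧ b ≤ l)

def Inv1 {n : ℕ} (τ : Equiv.Perm (Fin n)) (l y : ℕ) : Prop :=
  (∃ a c, Tri τ a c ∧ l ≤ a) ∧ (∃ a c, Tri τ a c ∧ c ≤ l + 1 + y) ∧
    (∃ a b, Asc τ a b ∧ b ≤ l + 1)

lemma bound2 (m : ℕ) : ∀ {n : ℕ} (τ : Equiv.Perm (Fin n)) (l y : ℕ), Inv2 τ l y →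
    (cnt m τ : ℤ) ≤ coeff m (Ws ^ (y + 1)) := by
  induction m with
  | zero =>
    intro n τ l y _
    rw [coeff_zero_Ws_pow]
    exact_mod_cast cnt_zero_le τ
  | succ m ih =>
    rintro n τ l y ⟨⟨a, c, t1, hla⟩, ⟨a', c', t2, hc'⟩, ⟨p, q, as, hq⟩⟩
    rw [Wpow_sum, map_add, coeff_succ_X_mul, map_sum, cnt_succ]
    have : coeff (m + 1) (1 : PowerSeries ℤ) = 0 := by simp [coeff_one]
    rw [this, zero_add, Nat.cast_sum]
    apply sum_window _ _ _ (l + 1)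
    · intro j _; exact NNS.pow NNS.Ws _ _
    · intro v hv h
      exact_mod_cast cnt_zero_below m t1 (by omega) (by omega)
    · intro v hv h
      exact_mod_cast cnt_zero_above m t2 (by omega) (by omega)
    · intro j hv hj
      apply ih _ l
      refine ⟨⟨_, _, t1.ext _ (by omega), hla.trans (le_sh _ _)⟩,
        ⟨_, _, Tri.new as (by omega) (by omega), le_rfl⟩, ⟨_, _, as.ext _ (by omega), ?_⟩⟩
      rw [sh_of_lt (by omega)]; exact hq

lemma bound1 (m : ℕ) : ∀ {n : ℕ} (τ : Equiv.Perm (Fin n)) (l y : ℕ), Inv1 τ l y →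
    (cnt m τ : ℤ) ≤ coeff m (Cs ^ (y + 1)) := by
  induction m with
  | zero =>
    intro n τ l y _
    rw [coeff_zero_Cs_pow]
    exact_mod_cast cnt_zero_le τ
  | succ m ih =>
    rintro n τ l y ⟨⟨a, c, t1, hla⟩, ⟨a', c', t2, hc'⟩, ⟨p, q, as, hq⟩⟩
    rw [Cpow_sum, map_add, coeff_succ_X_mul, map_sum, cnt_succ]
    have : coeff (m + 1) (1 : PowerSeries ℤ) = 0 := by simp [coeff_one]
    rw [this, zero_add, Nat.cast_sum]
    have e : ∑ j ∈ Finset.range (y + 1), coeff m (Cs ^ (j + 2)) =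
        ∑ j ∈ Finset.range (y + 1), coeff m (Cs ^ ((if j = 0 then y + 1 else j) + 1)) := by
      rw [Finset.sum_range_succ, Finset.sum_range_succ']
      simp
    rw [e]
    apply sum_window _ _ _ (l + 1)
    · intro j _; exact NNS.pow NNS.Cs _ _
    · intro v hv h
      exact_mod_cast cnt_zero_below m t1 (by omega) (by omega)
    · intro v hv h
      exact_mod_cast cnt_zero_above m t2 (by omega) (by omega)
    · intro j hv hj
      apply ih _ l
      refine ⟨⟨_, _, t1.ext _ (by omega), hla.trans (le_sh _ _)⟩, ?_⟩
      split_ifs with hj0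
      · subst hj0
        refine ⟨⟨_, _, t2.ext _ (by omega), ?_⟩, ⟨_, _, Asc.new τ (a := l) (by omega)
          (by omega), by omega⟩⟩
        have := sh_le (l + 1 + 0) c'
        omega
      · refine ⟨⟨_, _, Tri.new as (by omega) (by omega), le_rfl⟩, ⟨_, _, as.ext _ (by omega), ?_⟩⟩
        rw [sh_of_lt (by omega)]; exact hq

def Blocks {n : ℕ} (τ : Equiv.Perm (Fin n)) : ℕ → List ℕ → Prop
  | _, [] => True
  | s, L :: r => (1 ≤ L → Asc τ (s - 1) s) ∧ Blocks τ (s + L) r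

lemma Blocks.ext {n : ℕ} {τ : Equiv.Perm (Fin n)} {v : ℕ} (hv : v ≤ n) :
    ∀ (r : List ℕ) (s : ℕ), Blocks τ s r → v + 1 ≤ s → Blocks (extN τ v) (s + 1) r
  | [], _, _, _ => trivial
  | L :: r, s, h, hs => by
    refine ⟨fun hL => ?_, ?_⟩
    · have := (h.1 hL).ext v hv
      rw [sh_of_ge (by omega), sh_of_ge (by omega), show s - 1 + 1 = s + 1 - 1 by omega] at this
      exact this
    · have := Blocks.ext hv r (s + L) h.2 (by omega)
      rwa [show s + L + 1 = s + 1 + L by omega] at this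

def Inv0 {n : ℕ} (τ : Equiv.Perm (Fin n)) (k L : ℕ) (a : List ℕ) : Prop :=
  n = k + 1 + L + a.sum ∧ Blocks τ (k + 1) (L :: a) ∧ (a ≠ [] → 1 ≤ L)

lemma arch_bound (m : ℕ) {n : ℕ} (τ : Equiv.Perm (Fin n)) (p q : ℕ) (as : Asc τ p q) :
    ∀ (a : List ℕ) (s : ℕ), Blocks τ s a → q + 1 ≤ s → s + a.sum ≤ n →
    ∑ j ∈ Finset.range a.sum, (cnt m (extN τ (s + 1 + j)) : ℤ) ≤
      coeff m (a.map fun l => ∑ j ∈ Finset.range l, Ws ^ (j + 2)).sum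
  | [], _, _, _, _ => by simp
  | L :: r, s, h, hs, hn => by
    rw [List.sum_cons] at hn ⊢
    rw [Finset.sum_range_add, List.map_cons, List.sum_cons, map_add, map_sum]
    apply add_le_add
    · apply Finset.sum_le_sum
      intro j hj
      rw [Finset.mem_range] at hj
      have ha := h.1 (by omega)
      apply bound2 m _ (s - 1) (j + 1)
      refine ⟨⟨_, _, Tri.new ha (by omega) (by omega), le_rfl⟩,
        ⟨_, _, Tri.new ha (by omega) (by omega), by omega⟩, ⟨_, _, as.ext _ (by omega), ?_⟩⟩
      rw [sh_of_lt (by omega)]; omega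
    · have := arch_bound m τ p q as r (s + L) h.2 (by omega) (by omega)
      refine le_trans (le_of_eq ?_) this
      refine Finset.sum_congr rfl fun j _ => ?_
      rw [show s + 1 + (L + j) = s + L + 1 + j by omega]

lemma bound0 (m : ℕ) : ∀ {n : ℕ} (τ : Equiv.Perm (Fin n)) (k L : ℕ) (a : List ℕ),
    Inv0 τ k L a → (cnt m τ : ℤ) ≤ coeff m (Vs k L a) := by
  induction m with
  | zero =>
    intro n τ k L a _
    refine le_trans ?_ (coeff_zero_Vs k L a)
    exact_mod_cast cnt_zero_le τ
  | succ m ih =>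
    rintro n τ k L a ⟨hn, hb, ha⟩
    refine le_trans ?_ (NNS.le (Vs_step k L a) (m + 1))
    rw [coeff_succ_X_mul, cnt_succ, Nat.cast_sum]
    rw [show Finset.range (n + 1) = Finset.range (1 + k + 1 + L + a.sum) by congr 1; omega]
    simp only [Finset.sum_range_add, map_add, map_sum, Finset.sum_range_one, add_zero]
    have h0 : (cnt m (extN τ 0) : ℤ) ≤ coeff m (Vs (k + 1) L a) := by
      apply ih
      exact ⟨by omega, Blocks.ext (by omega) _ _ hb (by omega), ha⟩
    have h1 : ∑ i ∈ Finset.range k, (cnt m (extN τ (1 + i)) : ℤ) ≤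
        ∑ i ∈ Finset.range k, coeff m (Vs i (k - i + 1) (L :: a)) := by
      apply Finset.sum_le_sum
      intro i hi
      rw [Finset.mem_range] at hi
      apply ih
      refine ⟨by rw [List.sum_cons]; omega, ⟨fun _ => ?_, ?_⟩, fun _ => by omega⟩
      · rw [show 1 + i = i + 1 by omega]
        exact Asc.new τ (by omega) (by omega)
      · rw [show i + 1 + (k - i + 1) = k + 1 + 1 by omega]
        exact Blocks.ext (by omega) _ _ hb (by omega)
    have h2 : (cnt m (extN τ (1 + k)) : ℤ) ≤ coeff m (Vs k (L + 1) a) := by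
      apply ih
      refine ⟨by omega, ⟨fun _ => ?_, ?_⟩, fun _ => by omega⟩
      · rw [show 1 + k = k + 1 by omega]
        exact Asc.new τ (by omega) (by omega)
      · rcases eq_or_ne a [] with rfl | hne
        · trivial
        · have := ha hne
          exact Blocks.ext (s := k + 1 + L) (by omega) _ hb.2 (by omega)
    have h3 : ∑ j ∈ Finset.range L, (cnt m (extN τ (1 + k + 1 + j)) : ℤ) ≤
        ∑ j ∈ Finset.range L, coeff m (Cs ^ (j + 2)) := by
      apply Finset.sum_le_sum
      intro j hj
      rw [Finset.mem_range] at hj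
      have as := hb.1 (by omega)
      apply bound1 m _ k (j + 1)
      refine ⟨⟨_, _, Tri.new as (by omega) (by omega), by omega⟩,
        ⟨_, _, Tri.new as (by omega) (by omega), by omega⟩, ⟨_, _, as.ext _ (by omega), ?_⟩⟩
      rw [sh_of_lt (by omega)]
    have h4 : ∑ j ∈ Finset.range a.sum, (cnt m (extN τ (1 + k + 1 + L + j)) : ℤ) ≤
        coeff m (a.map fun l => ∑ j ∈ Finset.range l, Ws ^ (j + 2)).sum := by
      rcases eq_or_ne a [] with rfl | hne
      · simp
      · have hL := ha hne
        have := arch_bound m τ _ _ (hb.1 hL) a (k + 1 + L) hb.2 (by omega) (by omega)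
        rwa [show k + 1 + L + 1 = 1 + k + 1 + L by omega] at this
    linarith

lemma upper (m : ℕ) : avF (m + 1) ≤ 4 ^ (m + 1) := by
  have h : (cnt m (extN (1 : Equiv.Perm (Fin 0)) 0) : ℤ) ≤ coeff m (Vs 0 0 []) := by
    apply bound0
    exact ⟨rfl, ⟨fun h => absurd h (by omega), trivial⟩, fun h => absurd rfl h⟩
  have := h.trans (final_bound m)
  rw [avF_eq_cnt, cnt_succ]
  simp only [zero_add, Finset.sum_range_one]
  exact_mod_cast this

def LInv {n : ℕ} (τ : Equiv.Perm (Fin n)) (x : ℕ) : Prop :=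
  (∀ i j k : Fin n, i < j → j < k → τ i < τ j → ¬ τ j < τ k) ∧
  (∀ i j : Fin n, i < j → τ i < τ j → x ≤ (τ j : ℕ)) ∧ x ≤ n

lemma sh_lt_iff {v a b : ℕ} : sh v a < sh v b ↔ a < b := by
  unfold sh; split_ifs <;> omega

lemma LInv.ext {n : ℕ} {τ : Equiv.Perm (Fin n)} {x : ℕ} (h : LInv τ x) {v : ℕ} (hv : v ≤ x) :
    LInv (extN τ v) (if v = 0 then x + 1 else v) := by
  obtain ⟨h1, h2, h3⟩ := h
  have hvn : v ≤ n := by omega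
  have e1 : ∀ i : Fin n, (extN τ v i.castSucc : ℕ) = sh v (τ i) := extN_castSucc τ v hvn
  have e2 := extN_last τ v hvn
  refine ⟨?_, ?_, by split_ifs <;> omega⟩
  · intro i j k hij hjk
    induction k using Fin.lastCases with
    | last =>
      induction j using Fin.lastCases with
      | last => exact absurd hjk (lt_irrefl _)
      | cast j =>
        induction i using Fin.lastCases with
        | last => exact absurd hij (not_lt.2 (Fin.le_last _))
        | cast i =>
          simp only [Fin.lt_def, e1, e2, sh_lt_iff]
          intro hh
          have := h2 i j (by simpa using hij) hh
          have := le_sh v (τ j)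
          omega
    | cast k =>
      induction j using Fin.lastCases with
      | last => exact absurd hjk (not_lt.2 (Fin.le_last _))
      | cast j =>
        induction i using Fin.lastCases with
        | last => exact absurd hij (not_lt.2 (Fin.le_last _))
        | cast i =>
          simp only [Fin.lt_def, e1, sh_lt_iff]
          exact h1 i j k (by simpa using hij) (by simpa using hjk)
  · intro i j hij
    induction j using Fin.lastCases with
    | last =>
      induction i using Fin.lastCases with
      | last => exact absurd hij (lt_irrefl _)
      | cast i =>
        simp only [Fin.lt_def, e1, e2]
        intro hh
        split_ifs <;> omega
    | cast j =>
      induction i using Fin.lastCases with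
      | last => exact absurd hij (not_lt.2 (Fin.le_last _))
      | cast i =>
        simp only [Fin.lt_def, e1, sh_lt_iff]
        intro hh
        have := h2 i j (by simpa using hij) hh
        unfold sh
        split_ifs <;> omega

lemma lower (m : ℕ) : ∀ {n : ℕ} (τ : Equiv.Perm (Fin n)) (x : ℕ), LInv τ x →
    coeff m (Cs ^ (x + 1)) ≤ (cnt m τ : ℤ) := by
  induction m with
  | zero =>
    intro n τ x h
    rw [coeff_zero_Cs_pow]
    simp [cnt, good_of_no123 τ h.1]
  | succ m ih =>
    intro n τ x h
    rw [Cpow_sum, map_add, coeff_succ_X_mul, map_sum, cnt_succ]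
    have : coeff (m + 1) (1 : PowerSeries ℤ) = 0 := by simp [coeff_one]
    rw [this, zero_add, Nat.cast_sum]
    have hx := h.2.2
    have hsub : ∑ v ∈ Finset.range (x + 1), (cnt m (extN τ v) : ℤ) ≤
        ∑ v ∈ Finset.range (n + 1), (cnt m (extN τ v) : ℤ) := by
      apply Finset.sum_le_sum_of_subset_of_nonneg
      · exact Finset.range_mono (by omega)
      · intro _ _ _; positivity
    refine le_trans ?_ hsub
    rw [Finset.sum_range_succ, Finset.sum_range_succ']
    apply add_le_add
    · apply Finset.sum_le_sum
      intro i hi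
      rw [Finset.mem_range] at hi
      have := ih _ _ (h.ext (v := i + 1) (by omega))
      simpa using this
    · have := ih _ _ (h.ext (v := 0) (by omega))
      simpa using this

lemma catalan_le (n : ℕ) : catalan n ≤ avF n := by
  have := lower n (1 : Equiv.Perm (Fin 0)) 0 ⟨fun i => i.elim0, fun i => i.elim0, le_rfl⟩
  rw [avF_eq_cnt]
  rw [zero_add, pow_one, Cs, coeff_mk] at this
  exact_mod_cast this

lemma four_pow_le (n : ℕ) (hn : 3 ≤ n) : 4 ^ n ≤ n ^ 4 * avF n := by
  have h1 := Nat.four_pow_le_two_mul_self_mul_centralBinom n (by omega)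
  rw [← succ_mul_catalan_eq_centralBinom] at h1
  have h2 := catalan_le n
  calc 4 ^ n ≤ 2 * n * ((n + 1) * catalan n) := h1
    _ = (2 * n * (n + 1)) * catalan n := by ring
    _ ≤ n ^ 4 * avF n := by
        apply Nat.mul_le_mul _ h2
        have : 3 * 3 ≤ n * n := Nat.mul_le_mul hn hn
        nlinarith [Nat.mul_le_mul this (le_refl (n*n))]

lemma growth : Filter.Tendsto (fun n : ℕ => (avF n : ℝ) ^ (1 / (n : ℝ)))
      Filter.atTop (nhds 4) := by
  have hlow : Filter.Tendsto (fun n : ℕ => 4 / (((n : ℝ) ^ (1 / (n : ℝ))) ^ 4))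
      Filter.atTop (nhds 4) := by
    have h := (tendsto_rpow_div.comp tendsto_natCast_atTop_atTop (α := ℕ)).pow 4
    have h' := (tendsto_const_nhds (x := (4 : ℝ))).div h (by norm_num)
    simpa [Function.comp_def, Pi.div_def] using h'
  refine tendsto_of_tendsto_of_tendsto_of_le_of_le' hlow tendsto_const_nhds ?_ ?_
  · filter_upwards [Filter.eventually_ge_atTop 3] with n hn
    have hn0 : (0 : ℝ) < n := by exact_mod_cast (by omega : 0 < n)
    have h : (4 : ℝ) ^ n ≤ (n : ℝ) ^ 4 * avF n := by exact_mod_cast four_pow_le n hn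
    rw [div_le_iff₀ (by positivity)]
    calc (4 : ℝ) = ((4 : ℝ) ^ n) ^ (1 / (n : ℝ)) := by
          rw [one_div, Real.pow_rpow_inv_natCast (by norm_num) (by omega)]
      _ ≤ ((n : ℝ) ^ 4 * avF n) ^ (1 / (n : ℝ)) := by
          apply Real.rpow_le_rpow (by positivity) h (by positivity)
      _ = _ := by
          rw [Real.mul_rpow (by positivity) (by positivity), mul_comm]
          congr 1
          rw [← Real.rpow_natCast, ← Real.rpow_natCast, ← Real.rpow_mul (by positivity),
            ← Real.rpow_mul (by positivity), mul_comm]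
  · filter_upwards [Filter.eventually_ge_atTop 1] with n hn
    obtain ⟨m, rfl⟩ : ∃ m, n = m + 1 := ⟨n - 1, by omega⟩
    have h : (avF (m + 1) : ℝ) ≤ (4 : ℝ) ^ (m + 1) := by exact_mod_cast upper m
    calc _ ≤ ((4 : ℝ) ^ (m + 1)) ^ (1 / ((m + 1 : ℕ) : ℝ)) :=
          Real.rpow_le_rpow (by positivity) h (by positivity)
      _ = 4 := by rw [one_div, Real.pow_rpow_inv_natCast (by norm_num) (by omega)]

end Helpers

theorem av_1234_2341_growth_rate_four :
    (∀ n : ℕ, 1 ≤ n → avF n ≤ 4 ^ n) ∧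
    Filter.Tendsto (fun n : ℕ => (avF n : ℝ) ^ (1 / (n : ℝ)))
      Filter.atTop (nhds 4) := by
  refine ⟨fun n hn => ?_, growth⟩
  obtain ⟨m, rfl⟩ : ∃ m, n = m + 1 := ⟨n - 1, by omega⟩
  exact upper m
end
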